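/- arXiv:2506.20750 — 4 statements merged into one kernel-verified Lean document; each statement's English description precedes it below -/
import Mathlib

section
/- Let X be an irreducible sofic shift over a finite alphabet. Then there exist constants C > 0 and N₀ > 0, depending only on X, such that for every word w ∈ L(X) of length n > N₀ one has 0 ≤ h(X) − h(X_w) ≤ C/n. In particular, h(X_w) → h(X) as |w| → ∞. -/
open Filter Topology

section SubshiftBasics

variable {A : Type*}

/-- The left shift map on bi-infinite sequences. -/
def shiftZ (x : ℤ → A) : ℤ → A := fun i => x (i + 1)

/-- The word `w` occurs (as a subword) in the bi-infinite sequence `x`. -/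
def occursIn (w : List A) (x : ℤ → A) : Prop :=
  ∃ i : ℤ, ∀ k : Fin w.length, x (i + (k : ℕ)) = w.get k

/-- A subshift: a closed, shift-invariant subset of `A^ℤ` (prodiscrete topology). -/
def IsSubshift [TopologicalSpace A] (X : Set (ℤ → A)) : Prop :=
  IsClosed X ∧ ∀ x ∈ X, shiftZ x ∈ X

/-- The language of `X`: all finite words occurring in points of `X`. -/
def language (X : Set (ℤ → A)) : Set (List A) :=
  { w | ∃ x ∈ X, occursIn w x }

/-- The words of length `n` in the language of `X`. -/
def langN (X : Set (ℤ → A)) (n : ℕ) : Set (List A) :=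
  { w | w ∈ language X ∧ w.length = n }

/-- Topological entropy of a subshift, `lim (1/n) log #L_n(X)` (as a limsup,
which agrees with the limit when the latter exists). -/
noncomputable def entropy (X : Set (ℤ → A)) : ℝ :=
  Filter.limsup (fun n : ℕ => Real.log ((langN X n).ncard) / n) Filter.atTop

/-- The perturbation `X_w`: points of `X` not containing `w` as a subword. -/
def perturb (X : Set (ℤ → A)) (w : List A) : Set (ℤ → A) :=
  { x ∈ X | ¬ occursIn w x }

/-- Multi-word perturbation `X_K`. -/
def perturbFamily (X : Set (ℤ → A)) (K : Set (List A)) : Set (ℤ → A) :=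
  { x ∈ X | ∀ w ∈ K, ¬ occursIn w x }

/-- Irreducibility of a subshift. -/
def IrreducibleSubshift (X : Set (ℤ → A)) : Prop :=
  ∀ u ∈ language X, ∀ w ∈ language X, ∃ v, u ++ v ++ w ∈ language X

/-- `m` is a synchronizing word for `X`. -/
def IsSynchronizingWord (X : Set (ℤ → A)) (m : List A) : Prop :=
  m ∈ language X ∧
    ∀ u v : List A, u ++ m ∈ language X → m ++ v ∈ language X → u ++ m ++ v ∈ language X

/-- A synchronized system: an irreducible subshift possessing a synchronizing word. -/
def IsSynchronizedSystem (X : Set (ℤ → A)) : Prop :=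
  IrreducibleSubshift X ∧ ∃ m, IsSynchronizingWord X m

end SubshiftBasics
section Correlation

variable {A : Type*}

/-- `ℓ ∈ (u,w)`: overlap condition when the first symbol of `w` is placed below the
`(|u|-ℓ)`-th symbol of `u` (1-indexed); the overlapping parts agree. -/
def corrIdx (u w : List A) (ℓ : ℕ) : Prop :=
  ℓ < u.length ∧
    ∀ j : ℕ, j ≤ ℓ → j < w.length → u[u.length - 1 - ℓ + j]? = w[j]?

/-- The correlation set `(u,w) ⊆ {0,…,|u|−1}`. -/
def corrSet (u w : List A) : Set ℕ := { ℓ | corrIdx u w ℓ }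

open scoped Classical in
/-- The correlation set, as a finset. -/
noncomputable def corrFinset (u w : List A) : Finset ℕ :=
  (Finset.range u.length).filter (corrIdx u w)

/-- The correlation polynomial `(u,w)_z = Σ_{ℓ ∈ (u,w)} z^ℓ`. -/
noncomputable def corrPoly (u w : List A) (z : ℝ) : ℝ :=
  ∑ ℓ ∈ corrFinset u w, z ^ ℓ

end Correlation

/-- A labeled directed graph over the alphabet `A`. -/
structure LabeledGraph (A : Type*) where
  V : Type
  E : Type
  src : E → V
  tgt : E → V
  label : E → A

namespace LabeledGraph

variable {A : Type*} (G : LabeledGraph A)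

/-- Label sequences of bi-infinite walks in `G`. -/
def walkLabels : Set (ℤ → A) :=
  { x | ∃ e : ℤ → G.E, (∀ i, G.tgt (e i) = G.src (e (i + 1))) ∧ ∀ i, x i = G.label (e i) }

/-- A finite walk: a list of consecutively composable edges. -/
def IsWalk (p : List G.E) : Prop :=
  p.Chain' fun e f => G.tgt e = G.src f

/-- `G` presents the subshift `X`: `X` is the closure of the label sequences of
bi-infinite walks of `G`. -/
def Presents [TopologicalSpace A] (X : Set (ℤ → A)) : Prop :=
  X = closure G.walkLabels

/-- Graph irreducibility: a (nonempty) walk from any vertex to any other. -/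
def IrreducibleGraph : Prop :=
  ∀ u v : G.V, ∃ p : List G.E, p ≠ [] ∧ G.IsWalk p ∧
    p.head?.map G.src = some u ∧ p.getLast?.map G.tgt = some v

/-- `S_G(w)`: initial vertices of finite walks labeled `w`. -/
def startSet (w : List A) : Set G.V :=
  { v | ∃ p : List G.E, G.IsWalk p ∧ p.map G.label = w ∧ p.head?.map G.src = some v }

/-- `R_G(w)`: terminal vertices of finite walks labeled `w`. -/
def rangeSet (w : List A) : Set G.V :=
  { v | ∃ p : List G.E, G.IsWalk p ∧ p.map G.label = w ∧ p.getLast?.map G.tgt = some v }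

/-- The edge shift of the underlying graph of `G`. -/
def edgeShift : Set (ℤ → G.E) :=
  { e | ∀ i, G.tgt (e i) = G.src (e (i + 1)) }

/-- The sliding-block label map `ℓ_∞` on bi-infinite edge sequences. -/
def labelMapInf : (ℤ → G.E) → (ℤ → A) := fun e i => G.label (e i)

/-- Right-resolving: distinct edges with the same source carry distinct labels. -/
def RightResolving : Prop :=
  ∀ e f : G.E, G.src e = G.src f → G.label e = G.label f → e = f

end LabeledGraph

/-- A sofic shift: a subshift presented by a finite labeled directed graph. -/
def IsSofic {A : Type*} [TopologicalSpace A] (X : Set (ℤ → A)) : Prop :=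
  ∃ G : LabeledGraph A, Finite G.V ∧ Finite G.E ∧ G.Presents X

/-- A coded system: a subshift presented by a countable irreducible labeled directed graph. -/
def IsCoded {A : Type*} [TopologicalSpace A] (X : Set (ℤ → A)) : Prop :=
  ∃ G : LabeledGraph A, Countable G.V ∧ Countable G.E ∧ G.IrreducibleGraph ∧ G.Presents X

/-- Conjugacy of two subshifts over the alphabet `A`: a shift-commuting homeomorphism. -/
def Conjugate {A : Type*} [TopologicalSpace A] (X Y : Set (ℤ → A)) : Prop :=
  ∃ φ : X ≃ₜ Y, ∀ (x : ℤ → A) (hx : x ∈ X) (hx' : shiftZ x ∈ X),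
    (φ ⟨shiftZ x, hx'⟩ : ℤ → A) = shiftZ (φ ⟨x, hx⟩)

theorem mem_closure_pi_discrete {ι A : Type*} [TopologicalSpace A] [DiscreteTopology A]
    {S : Set (ι → A)} {x : ι → A} :
    x ∈ closure S ↔ ∀ F : Finset ι, ∃ y ∈ S, ∀ i ∈ F, y i = x i := by
  rw [mem_closure_iff]
  constructor
  · intro h F
    obtain ⟨y, hy, hyS⟩ := h ((F : Set ι).pi fun i => {x i})
      (isOpen_set_pi F.finite_toSet fun _ _ => isOpen_discrete _) (fun i _ => rfl)
    exact ⟨y, hyS, fun i hi => hy i hi⟩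
  · intro h o ho hx
    obtain ⟨F, u, hu, hsub⟩ := isOpen_pi_iff.1 ho x hx
    obtain ⟨y, hyS, hy⟩ := h F
    exact ⟨y, hsub fun i hi => by rw [hy i hi]; exact (hu i hi).2, hyS⟩

/-- The word `w` occurs in `x` at position `i`. -/
def OccursAt {A : Type*} (w : List A) (x : ℤ → A) (i : ℤ) : Prop :=
  ∀ k : ℕ, ∀ hk : k < w.length, x (i + k) = w[k]

theorem occursIn_iff_exists_occursAt {A : Type*} {w : List A} {x : ℤ → A} :
    occursIn w x ↔ ∃ i, OccursAt w x i :=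
  exists_congr fun _ => ⟨fun h k hk => h ⟨k, hk⟩, fun h k => h k k.2⟩

theorem occursAt_append {A : Type*} {u v : List A} {x : ℤ → A} {i : ℤ} :
    OccursAt (u ++ v) x i ↔ OccursAt u x i ∧ OccursAt v x (i + u.length) := by
  constructor
  · intro h
    refine ⟨fun k hk => ?_, fun k hk => ?_⟩
    · rw [h k (by simp; omega), List.getElem_append_left hk]
    · have := h (u.length + k) (by simp; omega)
      rw [List.getElem_append_right (by omega)] at this
      simpa [add_assoc] using this
  · rintro ⟨h₁, h₂⟩ k hk
    by_cases hku : k < u.length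
    · rw [h₁ k hku, List.getElem_append_left hku]
    · rw [List.getElem_append_right (by omega), ← h₂ (k - u.length) (by simp at hk; omega)]
      congr 1
      omega

theorem mem_language_of_append {A : Type*} {X : Set (ℤ → A)} {u v : List A}
    (h : u ++ v ∈ language X) : u ∈ language X ∧ v ∈ language X := by
  obtain ⟨x, hx, h⟩ := h
  obtain ⟨i, hi⟩ := occursIn_iff_exists_occursAt.1 h
  obtain ⟨h₁, h₂⟩ := occursAt_append.1 hi
  exact ⟨⟨x, hx, occursIn_iff_exists_occursAt.2 ⟨_, h₁⟩⟩,
    ⟨x, hx, occursIn_iff_exists_occursAt.2 ⟨_, h₂⟩⟩⟩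

namespace LabeledGraph

variable {A : Type*} (G : LabeledGraph A)

/-- Pairs of vertices joined by a walk labeled `u` that extends to a bi-infinite walk. -/
def transfer (u : List A) : Set (G.V × G.V) :=
  { p | ∃ e ∈ G.edgeShift, OccursAt u (G.labelMapInf e) 0 ∧
    G.src (e 0) = p.1 ∧ G.src (e u.length) = p.2 }

variable {G}

theorem edgeShift_translate {e : ℤ → G.E} (he : e ∈ G.edgeShift) (j : ℤ) :
    (fun i => e (i + j)) ∈ G.edgeShift := by
  intro i
  have := he (i + j)
  rw [this]
  congr 2
  ring

theorem labelMapInf_mem_walkLabels {e : ℤ → G.E} (he : e ∈ G.edgeShift) :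
    G.labelMapInf e ∈ G.walkLabels :=
  ⟨e, he, fun _ => rfl⟩

theorem mem_transfer_append {u v : List A} {a c : G.V} :
    (a, c) ∈ G.transfer (u ++ v) ↔ ∃ b, (a, b) ∈ G.transfer u ∧ (b, c) ∈ G.transfer v := by
  constructor
  · rintro ⟨e, he, hocc, ha, hc⟩
    obtain ⟨h₁, h₂⟩ := occursAt_append.1 hocc
    refine ⟨G.src (e u.length), ⟨e, he, h₁, ha, rfl⟩,
      ⟨_, edgeShift_translate he u.length, fun k hk => ?_, by simp, ?_⟩⟩
    · rw [← h₂ k hk]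
      simp only [labelMapInf]
      congr 2
      ring
    · rw [← hc]
      simp only [List.length_append, Nat.cast_add]
      congr 2
      ring
  · rintro ⟨b, ⟨e, he, h₁, ha, hb⟩, ⟨f, hf, h₂, hb', hc⟩⟩
    dsimp only at ha hb hb' hc
    refine ⟨fun i => if i < u.length then e i else f (i - u.length), fun i => ?_,
      occursAt_append.2 ⟨fun k hk => ?_, fun k hk => ?_⟩, ?_, ?_⟩
    · dsimp only
      rcases lt_trichotomy (i + 1) u.length with h | h | h
      · rw [if_pos (by omega), if_pos h]
        exact he i
      · rw [if_pos (by omega), if_neg (by omega), he i, h, hb, ← hb']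
        simp
      · rw [if_neg (by omega), if_neg (by omega), hf]
        congr 2
        ring
    · rw [← h₁ k hk]
      simp [labelMapInf, hk]
    · rw [← h₂ k hk]
      simp [labelMapInf, not_lt.2 (Int.natCast_nonneg k)]
    · dsimp only
      split_ifs with h
      · exact ha
      · have h0 : u.length = 0 := by omega
        rw [h0] at hb ⊢
        rw [← ha]
        simp only [Nat.cast_zero, sub_zero] at hb ⊢
        rw [hb, hb']
    · dsimp only
      rw [if_neg (by simp)]
      simpa using hc

theorem mem_language_iff_transfer_nonempty [TopologicalSpace A] [DiscreteTopology A]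
    {X : Set (ℤ → A)} (hG : G.Presents X) {u : List A} :
    u ∈ language X ↔ (G.transfer u).Nonempty := by
  constructor
  · rintro ⟨x, hx, hu⟩
    obtain ⟨i, hi⟩ := occursIn_iff_exists_occursAt.1 hu
    rw [hG, mem_closure_pi_discrete] at hx
    obtain ⟨y, ⟨e, he, hy⟩, hyx⟩ :=
      hx ((Finset.range u.length).image fun k : ℕ => i + (k : ℤ))
    refine ⟨(_, _), _, edgeShift_translate he i, fun k hk => ?_, rfl, rfl⟩
    rw [← hi k hk, ← hyx _ (Finset.mem_image_of_mem _ (Finset.mem_range.2 hk)), hy]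
    simp only [labelMapInf]
    congr 2
    ring
  · rintro ⟨_, e, he, hocc, -, -⟩
    refine ⟨G.labelMapInf e, ?_, occursIn_iff_exists_occursAt.2 ⟨0, hocc⟩⟩
    rw [hG]
    exact subset_closure (labelMapInf_mem_walkLabels he)

/-- Whether `y ++ u ++ z` is allowed depends on `u` only through `G.transfer u`. -/
theorem mem_language_congr [TopologicalSpace A] [DiscreteTopology A]
    {X : Set (ℤ → A)} (hG : G.Presents X) {u u' : List A}
    (huu' : G.transfer u = G.transfer u') (y z : List A) (h : y ++ u ++ z ∈ language X) :
    y ++ u' ++ z ∈ language X := by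
  rw [mem_language_iff_transfer_nonempty hG] at h ⊢
  obtain ⟨⟨a, d⟩, h⟩ := h
  obtain ⟨c, h₁, h₂⟩ := mem_transfer_append.1 h
  obtain ⟨b, h₃, h₄⟩ := mem_transfer_append.1 h₁
  exact ⟨(a, d), mem_transfer_append.2
    ⟨c, mem_transfer_append.2 ⟨b, h₃, huu' ▸ h₄⟩, h₂⟩⟩

theorem exists_isSynchronizingWord [TopologicalSpace A] [DiscreteTopology A] [Finite G.V]
    {X : Set (ℤ → A)} (hG : G.Presents X) (hne : (language X).Nonempty) :
    ∃ m, IsSynchronizingWord X m := by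
  let f : List A → ℕ := fun u => (Prod.snd '' G.transfer u).ncard
  obtain ⟨m, hm, hmin⟩ : ∃ m ∈ language X, ∀ u ∈ language X, f m ≤ f u := by
    have hne' : (f '' language X).Nonempty := hne.image f
    obtain ⟨m, hm, h⟩ := Nat.sInf_mem hne'
    exact ⟨m, hm, fun u hu => h ▸ Nat.sInf_le ⟨u, hu, rfl⟩⟩
  refine ⟨m, hm, fun u v hum hmv => ?_⟩
  have hsub : Prod.snd '' G.transfer (u ++ m) ⊆ Prod.snd '' G.transfer m := by
    rintro _ ⟨⟨a, c⟩, h, rfl⟩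
    obtain ⟨b, -, h⟩ := mem_transfer_append.1 h
    exact ⟨(b, c), h, rfl⟩
  have heq := Set.eq_of_subset_of_ncard_le hsub (hmin _ hum) (Set.toFinite _)
  rw [mem_language_iff_transfer_nonempty hG] at hmv ⊢
  obtain ⟨⟨a, c⟩, h⟩ := hmv
  obtain ⟨b, h₁, h₂⟩ := mem_transfer_append.1 h
  have hb : b ∈ Prod.snd '' G.transfer m := ⟨(a, b), h₁, rfl⟩
  rw [← heq] at hb
  obtain ⟨⟨a', b'⟩, h₃, rfl⟩ := hb
  exact ⟨(a', c), mem_transfer_append.2 ⟨_, h₃, h₂⟩⟩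

end LabeledGraph

section Entropy

theorem bddBelow_range_log_ncard_langN_div {A : Type*} (X : Set (ℤ → A)) :
    BddBelow (Set.range fun n : ℕ => Real.log ((langN X n).ncard) / n) := by
  refine ⟨0, ?_⟩
  rintro _ ⟨n, rfl⟩
  exact div_nonneg (Real.log_natCast_nonneg _) n.cast_nonneg

variable {A : Type*} [Fintype A] (X : Set (ℤ → A))

theorem finite_langN (n : ℕ) : (langN X n).Finite :=
  (List.finite_length_eq A n).subset fun _ h => h.2

theorem ncard_langN_add_le (m n : ℕ) :
    (langN X (m + n)).ncard ≤ (langN X m).ncard * (langN X n).ncard := by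
  rw [← Set.ncard_prod]
  refine Set.ncard_le_ncard_of_injOn (fun w => (w.take m, w.drop m)) ?_ ?_
    ((finite_langN X m).prod (finite_langN X n))
  · rintro w ⟨hw, hlen⟩
    rw [← List.take_append_drop m w] at hw
    obtain ⟨h₁, h₂⟩ := mem_language_of_append hw
    exact ⟨⟨h₁, by simp [hlen]⟩, ⟨h₂, by simp [hlen]⟩⟩
  · intro w _ w' _ h
    obtain ⟨h₁, h₂⟩ := Prod.ext_iff.1 h
    rw [← List.take_append_drop m w, ← List.take_append_drop m w']
    exact congrArg₂ _ h₁ h₂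

theorem subadditive_log_ncard_langN :
    Subadditive fun n => Real.log ((langN X n).ncard) := by
  intro m n
  have hle := ncard_langN_add_le X m n
  rcases Nat.eq_zero_or_pos (langN X (m + n)).ncard with h0 | hpos
  · simp only [h0, Nat.cast_zero, Real.log_zero]
    exact add_nonneg (Real.log_natCast_nonneg _) (Real.log_natCast_nonneg _)
  · have hm : (langN X m).ncard ≠ 0 := fun h => by simp [h] at hle; omega
    have hn : (langN X n).ncard ≠ 0 := fun h => by simp [h] at hle; omega
    rw [← Real.log_mul (by exact_mod_cast hm) (by exact_mod_cast hn)]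
    exact Real.log_le_log (by exact_mod_cast hpos) (by exact_mod_cast hle)

theorem tendsto_entropy :
    Tendsto (fun n : ℕ => Real.log ((langN X n).ncard) / n) atTop (𝓝 (entropy X)) := by
  have h := (subadditive_log_ncard_langN X).tendsto_lim (bddBelow_range_log_ncard_langN_div X)
  rwa [entropy, h.limsup_eq]

theorem entropy_nonneg : 0 ≤ entropy X :=
  ge_of_tendsto' (tendsto_entropy X)
    fun n => div_nonneg (Real.log_natCast_nonneg _) n.cast_nonneg

theorem exp_entropy_mul_le_ncard_langN {x : ℤ → A} (hx : x ∈ X) {n : ℕ} (hn : n ≠ 0) :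
    Real.exp (entropy X * n) ≤ (langN X n).ncard := by
  have hlim := (subadditive_log_ncard_langN X).tendsto_lim
    (bddBelow_range_log_ncard_langN_div X)
  have hle := (subadditive_log_ncard_langN X).lim_le_div
    (bddBelow_range_log_ncard_langN_div X) hn
  rw [tendsto_nhds_unique hlim (tendsto_entropy X), le_div_iff₀ (by positivity)] at hle
  have hpos : 0 < (langN X n).ncard := by
    rw [Set.ncard_pos (finite_langN X n)]
    refine ⟨List.ofFn fun k : Fin n => x (k : ℕ), ⟨x, hx, ?_⟩, by simp⟩
    exact occursIn_iff_exists_occursAt.2 ⟨0, fun k hk => by simp⟩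
  exact (Real.le_log_iff_exp_le (by exact_mod_cast hpos)).1 hle

variable {X}

theorem entropy_mono {Y : Set (ℤ → A)} (h : Y ⊆ X) : entropy Y ≤ entropy X := by
  refine le_of_tendsto_of_tendsto' (tendsto_entropy Y) (tendsto_entropy X) fun n => ?_
  have hsub : langN Y n ⊆ langN X n := fun w hw =>
    ⟨let ⟨x, hx, hxw⟩ := hw.1; ⟨x, h hx, hxw⟩, hw.2⟩
  have hle := Set.ncard_le_ncard hsub (finite_langN X n)
  refine div_le_div_of_nonneg_right ?_ n.cast_nonneg
  rcases Nat.eq_zero_or_pos (langN Y n).ncard with h0 | hpos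
  · simp only [h0, Nat.cast_zero, Real.log_zero]
    exact Real.log_natCast_nonneg _
  · exact Real.log_le_log (by exact_mod_cast hpos) (by exact_mod_cast hle)

theorem log_div_le_entropy {b N : ℕ} (hb : 0 < b) (hN : 0 < N)
    (h : ∀ j, b ^ j ≤ (langN X (j * N)).ncard) : Real.log b / N ≤ entropy X := by
  have hsub : Tendsto (fun j : ℕ => j * N) atTop atTop :=
    tendsto_id.atTop_mul_const' hN
  refine ge_of_tendsto ((tendsto_entropy X).comp hsub) ?_
  filter_upwards [eventually_gt_atTop 0] with j hj
  have hlog : j * Real.log b ≤ Real.log ((langN X (j * N)).ncard) := by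
    rw [← Real.log_pow]
    exact Real.log_le_log (by positivity) (by exact_mod_cast h j)
  simp only [Function.comp_apply, Nat.cast_mul]
  rw [div_le_div_iff₀ (by positivity) (by positivity)]
  nlinarith [mul_le_mul_of_nonneg_right hlog (Nat.cast_nonneg (α := ℝ) N)]

end Entropy

section Concatenation

variable {A : Type*}

/-- The concatenation `β q ++ β (q + 1) ++ ⋯ ++ β (q + j - 1)`. -/
def catBlocks (β : ℤ → List A) (q : ℤ) : ℕ → List A
  | 0 => []
  | j + 1 => catBlocks β q j ++ β (q + j)

theorem length_catBlocks {β : ℤ → List A} {N : ℕ} (hβ : ∀ q, (β q).length = N) (q : ℤ) (j : ℕ) :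
    (catBlocks β q j).length = j * N := by
  induction j with
  | zero => simp [catBlocks]
  | succ j ih => simp [catBlocks, ih, hβ, add_mul]

theorem occursAt_catBlocks {β : ℤ → List A} {N : ℕ} (hβ : ∀ q, (β q).length = N) {x : ℤ → A}
    (hx : ∀ q, OccursAt (β q) x (q * N)) (q : ℤ) (j : ℕ) :
    OccursAt (catBlocks β q j) x (q * N) := by
  induction j with
  | zero => intro k hk; simp [catBlocks] at hk
  | succ j ih =>
    refine occursAt_append.2 ⟨ih, ?_⟩
    rw [length_catBlocks hβ]
    convert hx (q + j) using 1
    push_cast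
    ring

theorem eq_of_catBlocks_eq {β γ : ℤ → List A} {N : ℕ} (hβ : ∀ q, (β q).length = N)
    (hγ : ∀ q, (γ q).length = N) {q : ℤ} {j : ℕ} (h : catBlocks β q j = catBlocks γ q j)
    {k : ℕ} (hk : k < j) : β (q + k) = γ (q + k) := by
  induction j with
  | zero => omega
  | succ j ih =>
    obtain ⟨h₁, h₂⟩ := List.append_inj h (by rw [length_catBlocks hβ, length_catBlocks hγ])
    rcases Nat.lt_succ_iff_lt_or_eq.1 hk with hk | rfl
    · exact ih h₁ hk
    · exact h₂

theorem exists_forall_occursAt {β : ℤ → List A} {N : ℕ} (hN : 0 < N)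
    (hβ : ∀ q, (β q).length = N) : ∃ x : ℤ → A, ∀ q, OccursAt (β q) x (q * N) := by
  have hN' : (0 : ℤ) < N := by exact_mod_cast hN
  refine ⟨fun i => (β (i / N))[(i % N).toNat]'(by
    rw [hβ]
    have := Int.emod_nonneg i hN'.ne'
    have := Int.emod_lt_of_pos i hN'
    omega), fun q k hk => ?_⟩
  have hk' : (k : ℤ) < N := by rw [hβ] at hk; exact_mod_cast hk
  have h₁ : (q * N + k) / (N : ℤ) = q := by
    rw [add_comm, Int.add_mul_ediv_right _ _ hN'.ne', Int.ediv_eq_zero_of_lt (by omega) hk',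
      zero_add]
  have h₂ : (q * N + k) % (N : ℤ) = k := by
    rw [add_comm, Int.add_mul_emod_self_right, Int.emod_eq_of_lt (by omega) hk']
  simp only [h₁, h₂, Int.toNat_natCast]

/-- Blocks starting with the word `m` that may be followed by `m` again. -/
def returnBlocks (X : Set (ℤ → A)) (m : List A) : Set (List A) :=
  { b | ∃ z, b = m ++ z ∧ m ++ z ++ m ∈ language X }

theorem catBlocks_append_mem_language {X : Set (ℤ → A)} {m : List A}
    (hm : IsSynchronizingWord X m) {β : ℤ → List A} (hβ : ∀ q, β q ∈ returnBlocks X m)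
    (q : ℤ) (j : ℕ) : catBlocks β q j ++ m ∈ language X := by
  induction j with
  | zero => exact hm.1
  | succ j ih =>
    obtain ⟨z, hz, hzm⟩ := hβ (q + j)
    have := hm.2 _ (z ++ m) ih (by simpa using hzm)
    simpa [catBlocks, hz] using this

theorem mem_of_forall_returnBlocks [TopologicalSpace A] [DiscreteTopology A]
    {G : LabeledGraph A} {X : Set (ℤ → A)} (hG : G.Presents X)
    {m : List A} (hm : IsSynchronizingWord X m) {β : ℤ → List A} {N : ℕ} (hN : 0 < N)
    (hβN : ∀ q, (β q).length = N) (hβ : ∀ q, β q ∈ returnBlocks X m) {x : ℤ → A}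
    (hx : ∀ q, OccursAt (β q) x (q * N)) : x ∈ X := by
  rw [hG, mem_closure_pi_discrete]
  intro F
  obtain ⟨Q, hQ⟩ : ∃ Q : ℕ, ∀ i ∈ F, i.natAbs ≤ Q :=
    ⟨F.sup Int.natAbs, fun i hi => Finset.le_sup (f := Int.natAbs) hi⟩
  let u := catBlocks β (-(Q : ℤ)) (2 * Q + 1)
  have hu : u ∈ language X :=
    (mem_language_of_append (catBlocks_append_mem_language hm hβ _ _)).1
  obtain ⟨_, e, he, hocc, -, -⟩ :=
    (LabeledGraph.mem_language_iff_transfer_nonempty hG).1 hu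
  have hux : OccursAt u x (-(Q : ℤ) * N) := occursAt_catBlocks hβN hx _ _
  have hlen : u.length = (2 * Q + 1) * N := length_catBlocks hβN _ _
  refine ⟨_, LabeledGraph.labelMapInf_mem_walkLabels
    (LabeledGraph.edgeShift_translate he ((Q : ℤ) * N)), fun i hi => ?_⟩
  have hiQ := hQ i hi
  have hQN : (Q : ℤ) ≤ Q * N := by
    exact_mod_cast Nat.le_mul_of_pos_right Q hN
  have hlen' : (u.length : ℤ) = 2 * (Q * N) + N := by
    rw [hlen]; push_cast; ring
  obtain ⟨k, hk⟩ : ∃ k : ℕ, (k : ℤ) = i + Q * N := ⟨(i + Q * N).toNat, by omega⟩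
  have hku : k < u.length := by omega
  have h₁ := hux k hku
  have h₂ := hocc k hku
  rw [hk] at h₁ h₂
  rw [show -(Q : ℤ) * N + (i + Q * N) = i by ring] at h₁
  rw [zero_add] at h₂
  exact h₂.trans h₁.symm

theorem not_occursIn_of_forall_window_ne {β : ℤ → List A} {N : ℕ} (hN : 0 < N)
    (hβN : ∀ q, (β q).length = N) {x : ℤ → A} (hx : ∀ q, OccursAt (β q) x (q * N))
    {w : List A} (hw : 2 * N ≤ w.length)
    (hβ : ∀ q, ∀ p ≤ N, β q ≠ (w.drop p).take N) : ¬ occursIn w x := by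
  rw [occursIn_iff_exists_occursAt]
  rintro ⟨i, hi⟩
  have hN' : (0 : ℤ) < N := by exact_mod_cast hN
  have hdm := Int.mul_ediv_add_emod i N
  have h0 := Int.emod_nonneg i hN'.ne'
  have h1 := Int.emod_lt_of_pos i hN'
  obtain ⟨p, hp⟩ : ∃ p : ℕ, (p : ℤ) = N - i % N := ⟨(N - i % N).toNat, by omega⟩
  refine hβ (i / N + 1) p (by omega) (List.ext_getElem ?_ fun k hk hk' => ?_)
  · rw [hβN, List.length_take, List.length_drop]
    omega
  · rw [← hx _ k hk, List.getElem_take, List.getElem_drop, ← hi (p + k) (by simp at hk'; omega)]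
    congr 1
    push_cast
    rw [hp]
    linear_combination hdm

theorem log_card_div_le_entropy_perturb [Fintype A] [TopologicalSpace A] [DiscreteTopology A]
    {G : LabeledGraph A} {X : Set (ℤ → A)} (hG : G.Presents X)
    {m : List A} (hm : IsSynchronizingWord X m) {N : ℕ} (hN : 0 < N)
    {w : List A} (hw : 2 * N ≤ w.length) {B : Finset (List A)} (hB : B.Nonempty)
    (hBN : ∀ b ∈ B, b.length = N) (hBX : ∀ b ∈ B, b ∈ returnBlocks X m)
    (hBw : ∀ b ∈ B, ∀ p ≤ N, b ≠ (w.drop p).take N) :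
    Real.log B.card / N ≤ entropy (perturb X w) := by
  refine log_div_le_entropy hB.card_pos hN fun j => ?_
  obtain ⟨b₀, hb₀⟩ := hB
  let β : (Fin j → B) → ℤ → List A := fun f q =>
    if h : q.toNat < j then f ⟨q.toNat, h⟩ else b₀
  have hβ : ∀ f q, β f q ∈ B := by
    intro f q
    by_cases h : q.toNat < j
    · simpa only [β, dif_pos h] using (f ⟨_, h⟩).2
    · simpa only [β, dif_neg h] using hb₀
  have hβN : ∀ f q, (β f q).length = N := fun f q => hBN _ (hβ f q)
  have hcard : (Set.univ : Set (Fin j → B)).ncard = B.card ^ j := by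
    simp [Set.ncard_univ]
  rw [← hcard]
  refine Set.ncard_le_ncard_of_injOn (fun f => catBlocks (β f) 0 j) (fun f _ => ?_)
    (fun f _ g _ hfg => ?_) (finite_langN _ _)
  · obtain ⟨x, hx⟩ := exists_forall_occursAt hN (hβN f)
    refine ⟨⟨x, ⟨?_, ?_⟩, occursIn_iff_exists_occursAt.2
      ⟨_, occursAt_catBlocks (hβN f) hx 0 j⟩⟩, length_catBlocks (hβN f) 0 j⟩
    · exact mem_of_forall_returnBlocks hG hm hN (hβN f) (fun q => hBX _ (hβ f q)) hx
    · exact not_occursIn_of_forall_window_ne hN (hβN f) hx hw fun q => hBw _ (hβ f q)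
  · funext k
    have := eq_of_catBlocks_eq (hβN f) (hβN g) hfg k.2
    simp only [β, zero_add, Int.toNat_natCast, k.2, dite_true] at this
    exact Subtype.ext this

end Concatenation

open scoped Classical in
/-- There are constants `K`, `D` such that for each `k` a proportion `1 / D` of the allowed words
of length `k` extends, by a common prefix and suffix, to return blocks of a common length in
`[k, k + K]`. -/
theorem exists_card_returnBlocks {A : Type*} [Fintype A] [TopologicalSpace A] [DiscreteTopology A]
    {G : LabeledGraph A} [Finite G.V] {X : Set (ℤ → A)} (hG : G.Presents X)
    (hXirr : IrreducibleSubshift X) {m : List A} (hm : m ∈ language X) :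
    ∃ K D : ℕ, 0 < D ∧ ∀ k, ∃ N, k ≤ N ∧ N ≤ k + K ∧ ∃ B : Finset (List A),
      (∀ b ∈ B, b.length = N) ∧ (∀ b ∈ B, b ∈ returnBlocks X m) ∧
      (langN X k).ncard ≤ B.card * D := by
  have := Fintype.ofFinite (Set (G.V × G.V))
  have hctx : ∀ t : Set (G.V × G.V), ∃ d : List A × List A, ∀ u ∈ language X,
      G.transfer u = t → m ++ d.1 ++ u ++ (d.2 ++ m) ∈ language X := by
    intro t
    by_cases ht : ∃ u ∈ language X, G.transfer u = t
    · obtain ⟨u, hu, rfl⟩ := ht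
      obtain ⟨v, hv⟩ := hXirr m hm u hu
      obtain ⟨v', hv'⟩ := hXirr _ hv m hm
      refine ⟨(v, v'), fun u' _ h => LabeledGraph.mem_language_congr hG h.symm _ _ ?_⟩
      simpa using hv'
    · exact ⟨([], []), fun u hu h => (ht ⟨u, hu, h⟩).elim⟩
  choose d hd using hctx
  let c : Set (G.V × G.V) → ℕ := fun t => m.length + (d t).1.length + (d t).2.length
  refine ⟨Finset.univ.sup c, Fintype.card (Set (G.V × G.V)), Fintype.card_pos, fun k => ?_⟩
  let L := (finite_langN X k).toFinset
  obtain ⟨t, -, ht⟩ := Finset.exists_max_image (Finset.univ : Finset (Set (G.V × G.V)))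
    (fun t => (L.filter fun u => G.transfer u = t).card) Finset.univ_nonempty
  have hcard := Finset.card_le_mul_card_image_of_maps_to
    (f := G.transfer) (s := L) (t := Finset.univ) (fun _ _ => Finset.mem_univ _) _ ht
  have hct : c t ≤ Finset.univ.sup c := Finset.le_sup (Finset.mem_univ t)
  refine ⟨k + c t, by omega, by omega,
    (L.filter fun u => G.transfer u = t).image fun u => m ++ (d t).1 ++ u ++ (d t).2, ?_, ?_, ?_⟩
  · intro b hb
    obtain ⟨u, hu, rfl⟩ := Finset.mem_image.1 hb
    have hu' : u ∈ langN X k := by simpa [L] using (Finset.mem_filter.1 hu).1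
    simp only [List.length_append, hu'.2, c]
    ring
  · intro b hb
    obtain ⟨u, hu, rfl⟩ := Finset.mem_image.1 hb
    obtain ⟨hu, hut⟩ := Finset.mem_filter.1 hu
    have hu' : u ∈ langN X k := by simpa [L] using hu
    exact ⟨(d t).1 ++ u ++ (d t).2, by simp, by simpa using hd t u hu'.1 hut⟩
  · rw [Finset.card_image_of_injective, Set.ncard_eq_toFinset_card _ (finite_langN X k)]
    · simpa using hcard
    · intro u v huv
      simpa using huv

open scoped Classical in
theorem entropy_sub_entropy_perturb_le {A : Type*} [Fintype A] [TopologicalSpace A]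
    [DiscreteTopology A] {X : Set (ℤ → A)} (hX : IsSofic X) (hXirr : IrreducibleSubshift X) :
    ∃ C N₀ : ℝ, 0 < C ∧ 0 < N₀ ∧ ∀ w ∈ language X, N₀ < (w.length : ℝ) →
      entropy X - entropy (perturb X w) ≤ C / (w.length : ℝ) := by
  obtain ⟨G, hV, -, hG⟩ := hX
  rcases (entropy_nonneg X).eq_or_lt with h0 | hpos
  · refine ⟨1, 1, one_pos, one_pos, fun w _ _ => ?_⟩
    have := entropy_nonneg (perturb X w)
    exact le_trans (by linarith) (div_nonneg zero_le_one w.length.cast_nonneg)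
  rcases (language X).eq_empty_or_nonempty with hempty | hne
  · exact ⟨1, 1, one_pos, one_pos, fun w hw => by simp [hempty] at hw⟩
  obtain ⟨m, hm⟩ := LabeledGraph.exists_isSynchronizingWord hG hne
  obtain ⟨x, hx, -⟩ := hm.1
  obtain ⟨K, D, hD, hblocks⟩ := exists_card_returnBlocks hG hXirr hm.1
  set h := entropy X
  have hD1 : (1 : ℝ) ≤ D := by exact_mod_cast hD
  have hlogD : 0 ≤ Real.log (2 * D) := Real.log_nonneg (by linarith)
  obtain ⟨k₀, hk₀⟩ := exists_nat_gt (4 * D * (K + 2) / h ^ 2)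
  refine ⟨4 * (h * K + Real.log (2 * D)) + 1, (4 * K + 2 * k₀ + 4 : ℕ), by positivity,
    by positivity, fun w _ hw => ?_⟩
  have hw' : 4 * K + 2 * k₀ + 4 < w.length := by exact_mod_cast hw
  obtain ⟨k, hk⟩ : ∃ k, k = w.length / 2 - K := ⟨_, rfl⟩
  obtain ⟨N, hkN, hNk, B, hBN, hBX, hBcard⟩ := hblocks k
  have hk1 : 1 ≤ k := by omega
  have hk1' : (1 : ℝ) ≤ k := by exact_mod_cast hk1
  have hkk₀ : (k₀ : ℝ) ≤ k := by exact_mod_cast (by omega : k₀ ≤ k)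
  have hNk' : (N : ℝ) ≤ k + K := by exact_mod_cast hNk
  have hkN' : (k : ℝ) ≤ N := by exact_mod_cast hkN
  let W : Finset (List A) := (Finset.range (N + 1)).image fun p => (w.drop p).take N
  have hWcard : W.card ≤ N + 1 := by
    simpa using Finset.card_image_le (s := Finset.range (N + 1))
      (f := fun p => (w.drop p).take N)
  have hsdiff : B.card ≤ (B \ W).card + (N + 1) := by
    have := Finset.le_card_sdiff W B
    omega
  have hsdiff' : (B.card : ℝ) ≤ (B \ W).card + (N + 1) := by exact_mod_cast hsdiff
  have hBcard' : Real.exp (h * k) ≤ B.card * D :=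
    (exp_entropy_mul_le_ncard_langN X hx (by omega)).trans (by exact_mod_cast hBcard)
  have hexp : 2 * D * (N + 1) ≤ Real.exp (h * k) := by
    have h₁ := Real.quadratic_le_exp_of_nonneg (x := h * k) (by positivity)
    have h₂ : 4 * D * (K + 2) ≤ k * h ^ 2 := by
      rw [div_lt_iff₀ (by positivity)] at hk₀
      nlinarith [sq_nonneg h]
    have h₃ : (N : ℝ) + 1 ≤ (K + 2) * k := by
      nlinarith [(Nat.cast_nonneg K : (0 : ℝ) ≤ K)]
    have h₄ : 2 * D * ((N : ℝ) + 1) ≤ 2 * D * ((K + 2) * k) := by gcongr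
    have h₅ := mul_le_mul_of_nonneg_right h₂ (by positivity : (0 : ℝ) ≤ k)
    have h₆ : 0 ≤ h * k := by positivity
    nlinarith
  have hBW : Real.exp (h * k) / (2 * D) ≤ (B \ W).card := by
    rw [div_le_iff₀ (by positivity)]
    nlinarith
  have hBWpos : (0 : ℝ) < (B \ W).card := lt_of_lt_of_le (by positivity) hBW
  have hlog : h * k - Real.log (2 * D) ≤ Real.log (B \ W).card := by
    rw [← Real.log_exp (h * k), ← Real.log_div (Real.exp_pos _).ne' (by positivity)]
    exact Real.log_le_log (by positivity) hBW
  have hmain := log_card_div_le_entropy_perturb hG hm (w := w) (B := B \ W) (N := N)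
    (by omega) (by omega) (Finset.card_pos.1 (by exact_mod_cast hBWpos))
    (fun b hb => hBN b (Finset.mem_sdiff.1 hb).1) (fun b hb => hBX b (Finset.mem_sdiff.1 hb).1)
    (fun b hb p hp hbp => (Finset.mem_sdiff.1 hb).2
      (Finset.mem_image.2 ⟨p, Finset.mem_range.2 (by omega), hbp.symm⟩))
  have hNpos : (0 : ℝ) < N := by linarith
  have hwpos : (0 : ℝ) < w.length := by exact_mod_cast (by omega : 0 < w.length)
  have hwN : (w.length : ℝ) ≤ 4 * N := by exact_mod_cast (by omega : w.length ≤ 4 * N)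
  have hdiff : h - Real.log (B \ W).card / N ≤ (h * K + Real.log (2 * D)) / N := by
    rw [sub_le_iff_le_add, ← add_div, le_div_iff₀ hNpos]
    nlinarith
  calc h - entropy (perturb X w) ≤ (h * K + Real.log (2 * D)) / N := by linarith
    _ ≤ (4 * (h * K + Real.log (2 * D)) + 1) / w.length := by
      have hc : 0 ≤ h * K + Real.log (2 * D) := by positivity
      rw [div_le_div_iff₀ hNpos hwpos]
      nlinarith [mul_le_mul_of_nonneg_left hwN hc]

/-- Perturbations of an irreducible sofic shift: the entropy drop is at most `C/n`
for words of length `n > N₀`; in particular `h(X_w) → h(X)` as `|w| → ∞`. -/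
theorem sofic_entropy_drop {A : Type*} [Fintype A] [TopologicalSpace A] [DiscreteTopology A]
    (X : Set (ℤ → A)) (hX : IsSofic X) (hXirr : IrreducibleSubshift X) :
    (∃ C N₀ : ℝ, 0 < C ∧ 0 < N₀ ∧ ∀ w ∈ language X, N₀ < (w.length : ℝ) →
      0 ≤ entropy X - entropy (perturb X w) ∧
        entropy X - entropy (perturb X w) ≤ C / (w.length : ℝ)) ∧
    (∀ ε : ℝ, 0 < ε → ∃ M : ℕ, ∀ w ∈ language X, M ≤ w.length →
      |entropy X - entropy (perturb X w)| ≤ ε) := by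
  have hnonneg : ∀ w, 0 ≤ entropy X - entropy (perturb X w) := fun w =>
    sub_nonneg.2 (entropy_mono fun _ hx => hx.1)
  obtain ⟨C, N₀, hC, hN₀, h⟩ := entropy_sub_entropy_perturb_le hX hXirr
  refine ⟨⟨C, N₀, hC, hN₀, fun w hw hwN => ⟨hnonneg w, h w hw hwN⟩⟩, fun ε hε => ?_⟩
  obtain ⟨M, hM⟩ := exists_nat_gt (max N₀ (C / ε))
  refine ⟨M, fun w hw hMw => ?_⟩
  have hMw' : (M : ℝ) ≤ w.length := by exact_mod_cast hMw
  have hwN : N₀ < w.length := ((le_max_left _ _).trans_lt hM).trans_le hMw'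
  have hwC : C / ε < w.length := ((le_max_right _ _).trans_lt hM).trans_le hMw'
  rw [abs_of_nonneg (hnonneg w)]
  refine (h w hw hwN).trans ?_
  rw [div_lt_iff₀ hε] at hwC
  rw [div_le_iff₀ (hN₀.trans hwN)]
  linarith
end

section
/- There exist a coded system X over a finite alphabet and a word w ∈ L(X) such that the perturbed subshift X_w is nonempty, infinite, and minimal (every orbit is dense in X_w); consequently X_w is irreducible and has no periodic points, and hence X_w is not a coded system (since every nonempty coded system contains periodic points). -/
open Filter Topology

/-- The two-sided orbit of a point under the shift. -/
def orbitZ {A : Type*} (x : ℤ → A) : Set (ℤ → A) :=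
  Set.range fun n : ℤ => fun i => x (i + n)

section Windows

variable {A : Type*}

theorem mem_closure_iff_windows [TopologicalSpace A] [DiscreteTopology A] {S : Set (ℤ → A)}
    {x : ℤ → A} :
    x ∈ closure S ↔ ∀ (i : ℤ) (L : ℕ), ∃ s ∈ S, ∀ j : ℕ, j < L → s (i + j) = x (i + j) := by
  constructor
  · intro hx i L
    have hopen : IsOpen {y : ℤ → A | ∀ j ∈ Finset.range L, y (i + j) = x (i + j)} := by
      have : {y : ℤ → A | ∀ j ∈ Finset.range L, y (i + j) = x (i + j)} =
          ⋂ j ∈ Finset.range L, (fun y : ℤ → A => y (i + j)) ⁻¹' {x (i + j)} := by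
        ext y
        simp
      rw [this]
      exact isOpen_biInter_finset fun j _ =>
        (isOpen_discrete _).preimage (continuous_apply (i + (j : ℤ)))
    obtain ⟨s, hs, hsS⟩ := mem_closure_iff.1 hx _ hopen (by simp)
    exact ⟨s, hsS, fun j hj => hs j (Finset.mem_range.2 hj)⟩
  · intro h
    rw [mem_closure_iff]
    intro o ho hxo
    obtain ⟨I, u, hu, hIu⟩ := isOpen_pi_iff.1 ho x hxo
    obtain ⟨N, hN⟩ : ∃ N : ℕ, ∀ n ∈ I, n.natAbs ≤ N :=
      ⟨I.sup Int.natAbs, fun n hn => Finset.le_sup (f := Int.natAbs) hn⟩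
    obtain ⟨s, hs, hsx⟩ := h (-N) (2 * N + 1)
    refine ⟨s, hIu fun n hn => ?_, hs⟩
    have hb := hN n hn
    have hj := hsx (n + N).toNat (by omega)
    have he : (-(N : ℤ) + ((n + N).toNat : ℤ)) = n := by omega
    rw [he] at hj
    rw [hj]
    exact (hu n hn).2

/-- The word of length `L` read in `x` from position `i`. -/
def windowWord (x : ℤ → A) (i : ℤ) (L : ℕ) : List A :=
  List.ofFn fun j : Fin L => x (i + (j : ℕ))

theorem occursIn_iff_windowWord {w : List A} {x : ℤ → A} :
    occursIn w x ↔ ∃ i, w = windowWord x i w.length := by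
  refine exists_congr fun i => ⟨fun h => ?_, fun h k => ?_⟩
  · refine List.ext_get (by simp [windowWord]) fun n h₁ h₂ => ?_
    simpa [windowWord] using (h ⟨n, h₁⟩).symm
  · have := List.getElem_of_eq h k.2
    simpa [windowWord] using this.symm

theorem windowWord_add (x : ℤ → A) (i : ℤ) (m n : ℕ) :
    windowWord x i (m + n) = windowWord x i m ++ windowWord x (i + m) n := by
  simp [windowWord, List.ofFn_add, add_assoc]

theorem windowWord_congr {x y : ℤ → A} {i a : ℤ} {L : ℕ}
    (h : ∀ j : ℕ, j < L → x (i + j) = y (a + j)) : windowWord x i L = windowWord y a L := by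
  simp only [windowWord]
  congr 1
  funext j
  exact h j j.2

end Windows

section CodedPeriodic

variable {A : Type*}

theorem LabeledGraph.IrreducibleGraph.exists_periodic {G : LabeledGraph A}
    (hG : G.IrreducibleGraph) (hne : G.walkLabels.Nonempty) :
    ∃ x ∈ G.walkLabels, ∃ p : ℕ, 0 < p ∧ (fun i => x (i + (p : ℤ))) = x := by
  obtain ⟨-, e₀, -, -⟩ := hne
  obtain ⟨p, hp, hwalk, hhead, hlast⟩ := hG (G.src (e₀ 0)) (G.src (e₀ 0))
  have hlen : 0 < p.length := List.length_pos_of_ne_nil hp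
  have hlt (i : ℤ) : (i % p.length).toNat < p.length := by
    have h1 := Int.emod_nonneg i (b := p.length) (by omega)
    have h2 := Int.emod_lt_of_pos i (b := p.length) (by omega)
    omega
  let e : ℤ → G.E := fun i => p[(i % p.length).toNat]'(hlt i)
  have hclose : G.tgt (p[p.length - 1]'(by omega)) = G.src (p[0]'hlen) := by
    rw [List.head?_eq_some_head hp] at hhead
    rw [List.getLast?_eq_some_getLast hp] at hlast
    simp only [Option.map_some, Option.some.injEq] at hhead hlast
    rw [List.head_eq_getElem] at hhead
    rw [List.getLast_eq_getElem] at hlast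
    rw [hlast, hhead]
  refine ⟨fun i => G.label (e i), ⟨e, fun i => ?_, fun i => rfl⟩, p.length, hlen, ?_⟩
  · have h1 := Int.emod_nonneg i (b := p.length) (by omega)
    have h2 := Int.emod_lt_of_pos i (b := p.length) (by omega)
    have hstep : (i + 1) % p.length = (i % p.length + 1) % p.length := by simp
    by_cases hj : i % p.length + 1 = p.length
    · rw [hj, Int.emod_self] at hstep
      have a1 : (i % p.length).toNat = p.length - 1 := by omega
      have a2 : ((i + 1) % p.length).toNat = 0 := by omega
      simp only [e, a1, a2]
      exact hclose
    · rw [Int.emod_eq_of_lt (a := i % p.length + 1) (by omega) (by omega)] at hstep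
      have a2 : ((i + 1) % p.length).toNat = (i % p.length).toNat + 1 := by omega
      simp only [e, a2]
      exact List.isChain_iff_getElem.1 hwalk _ (by omega)
  · funext i
    simp [e]

theorem IsCoded.exists_periodic [TopologicalSpace A] {X : Set (ℤ → A)} (hX : IsCoded X)
    (hne : X.Nonempty) : ∃ x ∈ X, ∃ p : ℕ, 0 < p ∧ (fun i => x (i + (p : ℤ))) = x := by
  obtain ⟨G, -, -, hG, hP⟩ := hX
  rw [LabeledGraph.Presents] at hP
  subst hP
  obtain ⟨x, hx, h⟩ := hG.exists_periodic (closure_nonempty_iff.1 hne)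
  exact ⟨x, subset_closure hx, h⟩

end CodedPeriodic

section PeriodDoubling

/-- The two-sided period-doubling sequence: the parity of the 2-adic valuation. -/
def periodDoubling (n : ℤ) : Fin 3 := if Even (padicValInt 2 n) then 0 else 1

theorem periodDoubling_ne_two (n : ℤ) : periodDoubling n ≠ 2 := by
  unfold periodDoubling
  split_ifs <;> decide

theorem periodDoubling_of_odd {n : ℤ} (h : Odd n) : periodDoubling n = 0 := by
  have : padicValInt 2 n = 0 := padicValInt.eq_zero_of_not_dvd (by
    have := Int.not_even_iff_odd.2 h
    rwa [even_iff_two_dvd] at this)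
  simp [periodDoubling, this]

theorem periodDoubling_two_mul {n : ℤ} (h : n ≠ 0) :
    periodDoubling (2 * n) = 1 - periodDoubling n := by
  have h2 : padicValInt 2 2 = 1 := by simpa using padicValInt_self (p := 2)
  have : padicValInt 2 (2 * n) = padicValInt 2 n + 1 := by
    rw [padicValInt.mul (by norm_num) h, h2, add_comm]
  simp only [periodDoubling, this, Nat.even_add_one]
  split_ifs <;> simp_all

theorem periodDoubling_two_pow_mul {u : ℤ} (hu : Odd u) (s : ℕ) :
    periodDoubling (2 ^ s * u) = if Even s then 0 else 1 := by
  induction s with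
  | zero => simpa using periodDoubling_of_odd hu
  | succ s ih =>
    have hu0 : u ≠ 0 := by rintro rfl; simp at hu
    rw [pow_succ', mul_assoc, periodDoubling_two_mul (by positivity), ih]
    simp only [Nat.even_add_one]
    split_ifs <;> simp_all

theorem periodDoubling_add_mul_two_pow (k : ℕ) :
    ∀ {n : ℤ}, ¬ (2 : ℤ) ^ k ∣ n → ∀ m : ℤ,
      periodDoubling (n + m * 2 ^ k) = periodDoubling n := by
  induction k with
  | zero => intro n h; simp at h
  | succ k ih =>
    intro n h m
    rcases Int.even_or_odd' n with ⟨n', rfl | rfl⟩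
    · have h' : ¬ (2 : ℤ) ^ k ∣ n' := fun hd => h (by rw [pow_succ']; exact mul_dvd_mul_left 2 hd)
      have hn : n' ≠ 0 := by rintro rfl; simp at h'
      have hn2 : n' + m * 2 ^ k ≠ 0 := fun h0 => h' ⟨-m, by linarith⟩
      rw [show 2 * n' + m * 2 ^ (k + 1) = 2 * (n' + m * 2 ^ k) by ring,
        periodDoubling_two_mul hn2, periodDoubling_two_mul hn, ih h']
    · rw [periodDoubling_of_odd ⟨n', rfl⟩, periodDoubling_of_odd ⟨n' + m * 2 ^ k, by ring⟩]

/-- Every word of the period-doubling sequence occurs along a full arithmetic progression. -/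
theorem periodDoubling_recurrent (a : ℤ) (L : ℕ) :
    ∃ a' P : ℤ, 0 < P ∧ ∀ (m : ℤ) (j : ℕ), j < L →
      periodDoubling (a' + m * P + j) = periodDoubling (a + j) := by
  obtain ⟨k, hk, hbig⟩ : ∃ k : ℕ, Even k ∧ (a.natAbs + L : ℤ) < 2 ^ k := by
    refine ⟨2 * (a.natAbs + L), even_two_mul _, ?_⟩
    have h1 : a.natAbs + L < 2 ^ (a.natAbs + L) := Nat.lt_two_pow_self
    have h2 : 2 ^ (a.natAbs + L) ≤ 2 ^ (2 * (a.natAbs + L)) :=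
      Nat.pow_le_pow_right (by norm_num) (by omega)
    exact_mod_cast h1.trans_le h2
  refine ⟨a + 2 ^ k, 2 ^ (k + 1), by positivity, fun m j hj => ?_⟩
  have hP : (2 : ℤ) ^ (k + 1) = 2 * 2 ^ k := pow_succ' 2 k
  rw [show a + 2 ^ k + m * 2 ^ (k + 1) + j = (a + j + 2 ^ k) + m * 2 ^ (k + 1) by ring,
    periodDoubling_add_mul_two_pow]
  · by_cases h0 : a + j = 0
    · have h1 := periodDoubling_two_pow_mul odd_one k
      rw [h0]
      simpa [hk, periodDoubling] using h1
    · have := periodDoubling_add_mul_two_pow k (n := a + j)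
        (fun hd => h0 (Int.eq_zero_of_abs_lt_dvd hd (by rw [abs_lt]; omega))) 1
      simpa using this
  · intro hd
    have := Int.le_of_dvd (by omega) hd
    omega

theorem periodDoubling_mismatch {p : ℕ} (hp : 0 < p) :
    ∃ r P : ℤ, 0 < P ∧ ∀ m : ℤ,
      periodDoubling (r + m * P + p) ≠ periodDoubling (r + m * P) := by
  obtain ⟨s, q, hq, rfl⟩ := Nat.exists_eq_two_pow_mul_odd hp.ne'
  refine ⟨2 ^ (s + 1) - (2 ^ s * q : ℕ), 2 ^ (s + 2), by positivity, fun m => ?_⟩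
  obtain ⟨c, rfl⟩ := hq
  rw [show (2 : ℤ) ^ (s + 1) - (2 ^ s * (2 * c + 1) : ℕ) + m * 2 ^ (s + 2)
        + (2 ^ s * (2 * c + 1) : ℕ) = 2 ^ (s + 1) * (2 * m + 1) by ring,
    show (2 : ℤ) ^ (s + 1) - (2 ^ s * (2 * c + 1) : ℕ) + m * 2 ^ (s + 2)
        = 2 ^ s * (2 * (2 * m - c) + 1) by push_cast; ring,
    periodDoubling_two_pow_mul ⟨m, rfl⟩, periodDoubling_two_pow_mul ⟨_, rfl⟩]
  simp only [Nat.even_add_one]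
  split_ifs <;> simp_all

/-- An arithmetic progression meets every interval as long as its step. -/
theorem exists_progression_mem_window (a b : ℤ) {P : ℤ} (hP : 0 < P) :
    ∃ (m : ℤ) (d : ℕ), (d : ℤ) < P ∧ a + m * P = b + d := by
  refine ⟨-((a - b) / P), ((a - b) % P).toNat, ?_, ?_⟩
  · have := Int.emod_lt_of_pos (a - b) hP
    omega
  · have h1 := Int.emod_nonneg (a - b) hP.ne'
    have h2 := Int.mul_ediv_add_emod (a - b) P
    rw [Int.toNat_of_nonneg h1]
    linarith

/-- The period-doubling subshift: all windows occur in the period-doubling sequence. -/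
def periodDoublingShift : Set (ℤ → Fin 3) :=
  {x | ∀ (i : ℤ) (L : ℕ), ∃ a : ℤ, ∀ j : ℕ, j < L → x (i + j) = periodDoubling (a + j)}

theorem periodDoubling_translate_mem (n : ℤ) :
    (fun i => periodDoubling (i + n)) ∈ periodDoublingShift :=
  fun i _ => ⟨i + n, fun j _ => by ring_nf⟩

theorem periodDoubling_mem : periodDoubling ∈ periodDoublingShift :=
  fun i _ => ⟨i, fun _ _ => rfl⟩

theorem periodDoublingShift_minimal {x y : ℤ → Fin 3} (hx : x ∈ periodDoublingShift)
    (hy : y ∈ periodDoublingShift) : y ∈ closure (orbitZ x) := by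
  rw [mem_closure_iff_windows]
  intro i L
  obtain ⟨a, ha⟩ := hy i L
  obtain ⟨a', P, hP, hrec⟩ := periodDoubling_recurrent a L
  obtain ⟨b, hb⟩ := hx 0 (P.toNat + L)
  obtain ⟨m, d, hd, hmd⟩ := exists_progression_mem_window a' b hP
  refine ⟨_, ⟨d - i, rfl⟩, fun j hj => ?_⟩
  have h1 := hb (d + j) (by omega)
  have h2 := hrec m j hj
  have e1 : i + j + (d - i) = 0 + ((d + j : ℕ) : ℤ) := by push_cast; ring
  have e2 : b + ((d + j : ℕ) : ℤ) = b + d + j := by push_cast; ring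
  rw [ha j hj, ← h2, hmd, ← e2, ← h1, ← e1]

theorem periodDoublingShift_aperiodic {x : ℤ → Fin 3} (hx : x ∈ periodDoublingShift) {p : ℕ}
    (hp : 0 < p) : (fun i => x (i + (p : ℤ))) ≠ x := by
  intro hper
  obtain ⟨r, P, hP, hmis⟩ := periodDoubling_mismatch hp
  obtain ⟨b, hb⟩ := hx 0 (P.toNat + p)
  obtain ⟨m, d, hd, hmd⟩ := exists_progression_mem_window r b hP
  apply hmis m
  have h1 := hb d (by omega)
  have h2 := hb (d + p) (by omega)
  have h3 := congrFun hper (0 + d)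
  rw [hmd, ← h1, ← h3, add_assoc, ← Nat.cast_add, ← h2]
  push_cast
  simp only [add_assoc]

theorem periodDoublingShift_infinite : periodDoublingShift.Infinite := by
  have hlt (m n : ℤ) (hmn : m < n) :
      (fun i => periodDoubling (i + m)) ≠ fun i => periodDoubling (i + n) := by
    intro h
    apply periodDoublingShift_aperiodic periodDoubling_mem (p := (n - m).toNat) (by omega)
    funext i
    have := congrFun h (i - m)
    simp only [sub_add_cancel] at this
    rw [this]
    congr 1
    omega
  refine Set.infinite_of_injective_forall_mem (f := fun n : ℤ => fun i => periodDoubling (i + n))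
    (fun m n h => ?_) periodDoubling_translate_mem
  rcases lt_trichotomy m n with hmn | rfl | hmn
  · exact (hlt m n hmn h).elim
  · rfl
  · exact (hlt n m hmn h.symm).elim

theorem exists_windowWord_of_mem_language {u : List (Fin 3)}
    (hu : u ∈ language periodDoublingShift) :
    ∃ a, u = windowWord periodDoubling a u.length := by
  obtain ⟨x, hx, hocc⟩ := hu
  obtain ⟨i, hi⟩ := occursIn_iff_windowWord.1 hocc
  obtain ⟨a, ha⟩ := hx i u.length
  exact ⟨a, hi.trans (windowWord_congr ha)⟩

theorem periodDoublingShift_irreducible : IrreducibleSubshift periodDoublingShift := by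
  intro u hu w hw
  obtain ⟨a, ha⟩ := exists_windowWord_of_mem_language hu
  obtain ⟨b, hb⟩ := exists_windowWord_of_mem_language hw
  obtain ⟨b', P, hP, hrec⟩ := periodDoubling_recurrent b w.length
  obtain ⟨m, d, -, hmd⟩ := exists_progression_mem_window b' (a + u.length) hP
  have hw' : w = windowWord periodDoubling (a + u.length + d) w.length := by
    rw [← hmd]
    exact hb.trans (windowWord_congr fun j hj => (hrec m j hj).symm)
  refine ⟨windowWord periodDoubling (a + u.length) d, periodDoubling, periodDoubling_mem,
    occursIn_iff_windowWord.2 ⟨a, ?_⟩⟩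
  have hlen : (windowWord periodDoubling (a + u.length) d).length = d := by simp [windowWord]
  rw [List.length_append, List.length_append, hlen, windowWord_add, windowWord_add, ← ha,
    Nat.cast_add, ← add_assoc, ← hw']

/-- A graph with vertex set `ℤ` which reads the period-doubling sequence along `n → n + 1`
and has an edge labeled `2` between any two vertices. -/
def periodDoublingGraph : LabeledGraph (Fin 3) where
  V := ℤ
  E := ℤ ⊕ (ℤ × ℤ)
  src := Sum.elim id Prod.fst
  tgt := Sum.elim (· + 1) Prod.snd
  label := Sum.elim periodDoubling fun _ => 2

theorem isCoded_closure_periodDoublingGraph :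
    IsCoded (closure periodDoublingGraph.walkLabels) := by
  refine ⟨periodDoublingGraph, inferInstanceAs (Countable ℤ),
    inferInstanceAs (Countable (ℤ ⊕ (ℤ × ℤ))), fun u v => ?_, rfl⟩
  exact ⟨[Sum.inr (u, v)], by simp, List.isChain_singleton _,
    by simp [periodDoublingGraph], by simp [periodDoublingGraph]⟩

theorem periodDoubling_translate_mem_walkLabels (n : ℤ) :
    (fun i => periodDoubling (i + n)) ∈ periodDoublingGraph.walkLabels :=
  ⟨fun i => Sum.inl (i + n), fun i => by simp [periodDoublingGraph]; ring, fun _ => rfl⟩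

theorem occursIn_singleton {A : Type*} {c : A} {x : ℤ → A} : occursIn [c] x ↔ ∃ i, x i = c := by
  simp [occursIn]

/-- A stretch of a walk whose labels avoid `2` reads off a window of the sequence. -/
theorem walkLabels_window {s : ℤ → Fin 3} (hs : s ∈ periodDoublingGraph.walkLabels) (i : ℤ)
    (L : ℕ) (h : ∀ j : ℕ, j < L → s (i + j) ≠ 2) :
    ∃ a : ℤ, ∀ j : ℕ, j < L → s (i + j) = periodDoubling (a + j) := by
  obtain ⟨e, hwalk, hlab⟩ := hs
  have hinl (j : ℕ) (hj : j < L) : ∃ b : ℤ, e (i + j) = Sum.inl b := by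
    rcases he : e (i + j) with b | b
    · exact ⟨b, rfl⟩
    · exact (h j hj (by rw [hlab, he]; rfl)).elim
  rcases Nat.eq_zero_or_pos L with rfl | hL
  · exact ⟨0, by simp⟩
  obtain ⟨a, ha⟩ := hinl 0 hL
  have key (j : ℕ) (hj : j < L) : e (i + j) = Sum.inl (a + j) := by
    induction j with
    | zero => simpa using ha
    | succ j ih =>
      obtain ⟨b, hb⟩ := hinl (j + 1) hj
      have hstep := hwalk (i + j)
      rw [ih (by omega), add_assoc, ← Nat.cast_succ, hb] at hstep
      have hb' : a + j + 1 = b := hstep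
      rw [hb, ← hb']
      push_cast
      rw [add_assoc]
  exact ⟨a, fun j hj => by rw [hlab, key j hj]; rfl⟩

theorem perturb_closure_periodDoublingGraph :
    perturb (closure periodDoublingGraph.walkLabels) [2] = periodDoublingShift := by
  ext x
  constructor
  · rintro ⟨hx, h2⟩ i L
    rw [occursIn_singleton, not_exists] at h2
    obtain ⟨s, hs, hsx⟩ := mem_closure_iff_windows.1 hx i L
    obtain ⟨a, ha⟩ := walkLabels_window hs i L fun j hj => by rw [hsx j hj]; exact h2 _
    exact ⟨a, fun j hj => (hsx j hj).symm.trans (ha j hj)⟩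
  · refine fun hx => ⟨mem_closure_iff_windows.2 fun i L => ?_, ?_⟩
    · obtain ⟨a, ha⟩ := hx i L
      refine ⟨_, periodDoubling_translate_mem_walkLabels (a - i), fun j hj => ?_⟩
      rw [ha j hj]
      congr 1
      ring
    · rw [occursIn_singleton]
      rintro ⟨i, hi⟩
      obtain ⟨a, ha⟩ := hx i 1
      have := ha 0 one_pos
      simp only [Nat.cast_zero, add_zero, hi] at this
      exact periodDoubling_ne_two a this.symm

theorem two_mem_language_closure_periodDoublingGraph :
    [2] ∈ language (closure periodDoublingGraph.walkLabels) :=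
  ⟨fun _ => 2, subset_closure ⟨fun _ => Sum.inr (0, 0), fun _ => rfl, fun _ => rfl⟩,
    occursIn_singleton.2 ⟨0, rfl⟩⟩

end PeriodDoubling

/-- There is a coded system whose perturbation by a word is a nonempty, infinite,
minimal (hence irreducible) subshift without periodic points, and therefore not coded. -/
theorem exists_coded_with_noncoded_perturbation :
    ∃ (X : Set (ℤ → Fin 3)) (w : List (Fin 3)),
      IsCoded X ∧ w ∈ language X ∧
      (perturb X w).Nonempty ∧
      (perturb X w).Infinite ∧
      (∀ x ∈ perturb X w, ∀ y ∈ perturb X w, y ∈ closure (orbitZ x)) ∧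
      IrreducibleSubshift (perturb X w) ∧
      (∀ x ∈ perturb X w, ∀ p : ℕ, 0 < p → (fun i => x (i + (p : ℤ))) ≠ x) ∧
      ¬ IsCoded (perturb X w) := by
  refine ⟨closure periodDoublingGraph.walkLabels, [2], isCoded_closure_periodDoublingGraph,
    two_mem_language_closure_periodDoublingGraph, ?_⟩
  rw [perturb_closure_periodDoublingGraph]
  refine ⟨⟨_, periodDoubling_mem⟩, periodDoublingShift_infinite,
    fun x hx y hy => periodDoublingShift_minimal hx hy, periodDoublingShift_irreducible,
    fun x hx p hp => periodDoublingShift_aperiodic hx hp, fun hc => ?_⟩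
  obtain ⟨x, hx, p, hp, hper⟩ := hc.exists_periodic ⟨_, periodDoubling_mem⟩
  exact periodDoublingShift_aperiodic hx hp hper
end

section
/- Let A be an N×N irreducible matrix with nonnegative integer entries, X = X_A its edge shift, and let K = {w_1,…,w_k} ⊆ L(X) be a reduced collection (w_i is not a subword of w_j for i ≠ j). Fix the vertex 1 of G_A. For n ≥ 1 and 1 ≤ i ≤ N let f(n,i) be the number of walks of length n in G_A from vertex 1 to vertex i that contain no word of K, with f(0,i) = δ_{i,1}; for v ∈ K let g(n,v) be the number of walks of length n in G_A starting at vertex 1 whose only occurrence of a word of K is an occurrence of v as a suffix, with g(0,v) = 0. Set F_i(z) = Σ_{n≥0} f(n,i) z^{−n} and G_v(z) = Σ_{n≥0} g(n,v) z^{−n}, convergent for real z > λ_A. Define the (N+k)×(N+k) block matrix P(z) = [[zI − Aᵀ, R(z)], [S(z), −z·M(z)]], where R(z)_{i,j} = z if i = r(w_j) and 0 otherwise (1 ≤ i ≤ N, 1 ≤ j ≤ k), S(z)_{i,j} = 1 if j = s(w_i) and 0 otherwise (1 ≤ i ≤ k, 1 ≤ j ≤ N), and M(z)_{i,j} = (w_j,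 w_i)_z. Then for every real z > λ_A, P(z)·(F_1(z),…,F_N(z), G_{w_1}(z),…,G_{w_k}(z))ᵀ = (z, 0, …, 0)ᵀ. Consequently, for all sufficiently large real z, P(z) is invertible and Σ_{n≥0} f(n) z^{−n} = z·Σ_{i=1}^N (P(z)^{−1})_{i,1}, where f(n) = Σ_{i=1}^N f(n,i). -/
open Filter Topology

open scoped Matrix

/-- The edge type of the graph `G_A` associated with a nonnegative integer matrix `A`:
`A i j` parallel edges from `i` to `j`. -/
def MatEdge {N : ℕ} (A : Matrix (Fin N) (Fin N) ℕ) : Type :=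
  Σ i : Fin N, Σ j : Fin N, Fin (A i j)

/-- Source of an edge of `G_A`. -/
def eSrc {N : ℕ} {A : Matrix (Fin N) (Fin N) ℕ} (e : MatEdge A) : Fin N := e.1

/-- Range of an edge of `G_A`. -/
def eTgt {N : ℕ} {A : Matrix (Fin N) (Fin N) ℕ} (e : MatEdge A) : Fin N := e.2.1

/-- A finite walk in `G_A`. -/
def IsMatWalk {N : ℕ} (A : Matrix (Fin N) (Fin N) ℕ) (p : List (MatEdge A)) : Prop :=
  p.Chain' fun e f => eTgt e = eSrc f

/-- The source vertex of a walk (defaulting to `v₀` for the empty walk). -/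
def wSrc {N : ℕ} {A : Matrix (Fin N) (Fin N) ℕ} (v₀ : Fin N) (p : List (MatEdge A)) : Fin N :=
  (p.head?.map eSrc).getD v₀

/-- The range vertex of a walk (defaulting to `v₀` for the empty walk). -/
def wTgt {N : ℕ} {A : Matrix (Fin N) (Fin N) ℕ} (v₀ : Fin N) (p : List (MatEdge A)) : Fin N :=
  (p.getLast?.map eTgt).getD v₀

open scoped Classical in
/-- `f(n,i)`: the number of walks of length `n` in `G_A` from `v₀` to `i` containing no
word of the collection `ws`, with `f(0,i) = δ_{i,v₀}`. -/
noncomputable def fW {N k : ℕ} (A : Matrix (Fin N) (Fin N) ℕ) (v₀ : Fin N)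
    (ws : Fin k → List (MatEdge A)) (n : ℕ) (i : Fin N) : ℕ :=
  if n = 0 then (if i = v₀ then 1 else 0) else
    ({ p : List (MatEdge A) | p.length = n ∧ IsMatWalk A p ∧
        p.head?.map eSrc = some v₀ ∧ p.getLast?.map eTgt = some i ∧
        ∀ j : Fin k, ¬ ws j <:+: p }).ncard

open scoped Classical in
/-- `g(n,v)`: the number of walks of length `n` in `G_A` starting at `v₀` whose unique
occurrence of a word of the collection is `ws i` as a suffix, with `g(0,v) = 0`. -/
noncomputable def gW {N k : ℕ} (A : Matrix (Fin N) (Fin N) ℕ) (v₀ : Fin N)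
    (ws : Fin k → List (MatEdge A)) (n : ℕ) (i : Fin k) : ℕ :=
  if n = 0 then 0 else
    ({ p : List (MatEdge A) | p.length = n ∧ IsMatWalk A p ∧
        p.head?.map eSrc = some v₀ ∧ ws i <:+ p ∧
        ∀ (j : Fin k) (t : ℕ), ws j <+: p.drop t →
          j = i ∧ t + (ws j).length = p.length }).ncard

open scoped Classical in
/-- The block matrix `P(z) = [[zI − Aᵀ, R(z)], [S(z), −z·M(z)]]`. -/
noncomputable def Pmat {N k : ℕ} (A : Matrix (Fin N) (Fin N) ℕ) (v₀ : Fin N)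
    (ws : Fin k → List (MatEdge A)) (z : ℝ) :
    Matrix (Fin N ⊕ Fin k) (Fin N ⊕ Fin k) ℝ :=
  Matrix.fromBlocks
    (z • (1 : Matrix (Fin N) (Fin N) ℝ) - (A.map (Nat.cast : ℕ → ℝ)).transpose)
    (Matrix.of fun i j => if i = wTgt v₀ (ws j) then z else 0)
    (Matrix.of fun i j => if j = wSrc v₀ (ws i) then 1 else 0)
    (-(z • Matrix.of fun i j => corrPoly (ws j) (ws i) z))


section
variable {N k : ℕ} {A : Matrix (Fin N) (Fin N) ℕ}

instance MatEdge.instFinite : Finite (MatEdge A) := by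
  have (i j : Fin N) : Finite (Fin (A i j)) := inferInstance
  exact inferInstanceAs (Finite (Σ i : Fin N, Σ j : Fin N, Fin (A i j)))

/-- The `a`-th edge of `G_A` from `i` to `j`. -/
def matEdge {i j : Fin N} (a : Fin (A i j)) : MatEdge A := ⟨i, j, a⟩

@[simp] theorem eSrc_matEdge {i j : Fin N} (a : Fin (A i j)) : eSrc (matEdge a) = i := rfl

@[simp] theorem eTgt_matEdge {i j : Fin N} (a : Fin (A i j)) : eTgt (matEdge a) = j := rfl

theorem exists_eq_matEdge (e : MatEdge A) : ∃ (i j : Fin N) (a : Fin (A i j)), e = matEdge a :=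
  ⟨e.1, e.2.1, e.2.2, rfl⟩

theorem isMatWalk_iff_isChain (p : List (MatEdge A)) :
    IsMatWalk A p ↔ p.IsChain fun e f => eTgt e = eSrc f :=
  Iff.rfl

/-- `p` is a (possibly empty) walk in `G_A` starting at the vertex `v`. -/
def IsWalkFrom (v : Fin N) (p : List (MatEdge A)) : Prop :=
  IsMatWalk A p ∧ ∀ e ∈ p.head?, eSrc e = v

/-- `p` contains none of the words `ws`. -/
def Avoids {α : Type*} (ws : Fin k → List α) (p : List α) : Prop :=
  ∀ j, ¬ ws j <:+: p

theorem isWalkFrom_append (v : Fin N) (p r : List (MatEdge A)) :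
    IsWalkFrom v (p ++ r) ↔ IsWalkFrom v p ∧ IsWalkFrom (wTgt v p) r := by
  simp only [IsWalkFrom, isMatWalk_iff_isChain, wTgt]
  rw [List.isChain_append]
  rcases p.eq_nil_or_concat' with rfl | ⟨p, e, rfl⟩
  · simp
  · cases r <;> simp; grind

theorem Avoids.of_infix {α : Type*} {ws : Fin k → List α} {p q : List α} (h : Avoids ws q)
    (hpq : p <:+: q) : Avoids ws p := fun j hj => h j (hj.trans hpq)

/-- The walks counted by `fW`. -/
def avoidingWalks (A : Matrix (Fin N) (Fin N) ℕ) (v : Fin N) (ws : Fin k → List (MatEdge A))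
    (n : ℕ) (i : Fin N) : Set (List (MatEdge A)) :=
  {p | p.length = n ∧ IsWalkFrom v p ∧ wTgt v p = i ∧ Avoids ws p}

/-- The walks from `v` of length `n` in which `ws i` occurs as a suffix, and whose proper
prefixes contain none of the words `ws`. -/
def firstHitWalks (A : Matrix (Fin N) (Fin N) ℕ) (v : Fin N) (ws : Fin k → List (MatEdge A))
    (n : ℕ) (i : Fin k) : Set (List (MatEdge A)) :=
  {p | p.length = n ∧ IsWalkFrom v p ∧ ws i <:+ p ∧ Avoids ws p.dropLast}

theorem finite_avoidingWalks (v : Fin N) (ws : Fin k → List (MatEdge A)) (n : ℕ) (i : Fin N) :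
    (avoidingWalks A v ws n i).Finite :=
  (List.finite_length_eq _ n).subset fun _ hp => hp.1

theorem finite_firstHitWalks (v : Fin N) (ws : Fin k → List (MatEdge A)) (n : ℕ) (i : Fin k) :
    (firstHitWalks A v ws n i).Finite :=
  (List.finite_length_eq _ n).subset fun _ hp => hp.1

theorem fW_eq_ncard (v : Fin N) {ws : Fin k → List (MatEdge A)} (hne : ∀ i, ws i ≠ [])
    (n : ℕ) (i : Fin N) : fW A v ws n i = (avoidingWalks A v ws n i).ncard := by
  unfold fW
  split_ifs with hn hi
  · subst hn hi
    rw [eq_comm, Set.ncard_eq_one]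
    refine ⟨[], ?_⟩
    ext p
    simp only [avoidingWalks, Set.mem_ofPred_eq, Set.mem_singleton_iff, List.length_eq_zero_iff]
    refine ⟨fun h => h.1, ?_⟩
    rintro rfl
    simp [IsWalkFrom, isMatWalk_iff_isChain, wTgt, Avoids, hne]
  · subst hn
    rw [eq_comm, Set.ncard_eq_zero (finite_avoidingWalks ..), Set.eq_empty_iff_forall_notMem]
    rintro p ⟨hp, -, h, -⟩
    rw [List.length_eq_zero_iff] at hp
    subst hp
    exact hi h.symm
  · congr 1
    ext p
    simp only [avoidingWalks, Set.mem_ofPred_eq, IsWalkFrom, wTgt, Avoids]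
    rcases p.eq_nil_or_concat' with rfl | ⟨r, e, rfl⟩
    · simp; grind
    · cases r <;> simp <;> grind

theorem eq_of_suffix_of_suffix {α : Type*} {ws : Fin k → List α}
    (hred : ∀ i j : Fin k, i ≠ j → ¬ ws i <:+: ws j) {p : List α} {i j : Fin k}
    (hi : ws i <:+ p) (hj : ws j <:+ p) : i = j := by
  by_contra hij
  rcases List.suffix_or_suffix_of_suffix hi hj with h | h
  · exact hred i j hij h.isInfix
  · exact hred j i (Ne.symm hij) h.isInfix

theorem unique_occurrence_iff {α : Type*} {ws : Fin k → List α} (hne : ∀ i, ws i ≠ [])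
    (hred : ∀ i j : Fin k, i ≠ j → ¬ ws i <:+: ws j) {p : List α} {i : Fin k}
    (hi : ws i <:+ p) :
    (∀ (j : Fin k) (t : ℕ), ws j <+: p.drop t → j = i ∧ t + (ws j).length = p.length) ↔
      Avoids ws p.dropLast := by
  constructor
  · rintro h j ⟨s, t, hst⟩
    have hp : p ≠ [] := by
      rintro rfl
      exact hne i (by simpa using hi)
    have hpe := List.dropLast_append_getLast hp
    have := (h j s.length ⟨t ++ [p.getLast hp], by
      conv_rhs => rw [← hpe, ← hst]
      simp⟩).2
    have hlen := congrArg List.length hst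
    have := List.length_pos_iff.2 hp
    simp at hlen
    omega
  · intro h j t hjt
    have hlen := hjt.length_le
    rw [List.length_drop] at hlen
    have hpos := List.length_pos_iff.2 (hne j)
    obtain ⟨r, hr⟩ := hjt
    have hpe : p = p.take t ++ ws j ++ r := by
      rw [List.append_assoc, hr, List.take_append_drop]
    have hr0 : r = [] := by
      by_contra hr0
      refine h j ⟨p.take t, r.dropLast, ?_⟩
      conv_rhs => rw [hpe]
      rw [List.dropLast_append_of_ne_nil hr0]
    subst hr0
    refine ⟨eq_of_suffix_of_suffix hred ⟨p.take t, by simpa using hpe.symm⟩ hi, ?_⟩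
    have := congrArg List.length hr
    simp at this
    have := List.length_pos_iff.2 (hne j)
    omega

theorem gW_eq_ncard (v : Fin N) {ws : Fin k → List (MatEdge A)} (hne : ∀ i, ws i ≠ [])
    (hred : ∀ i j : Fin k, i ≠ j → ¬ ws i <:+: ws j)
    (n : ℕ) (i : Fin k) : gW A v ws n i = (firstHitWalks A v ws n i).ncard := by
  unfold gW
  split_ifs with hn
  · subst hn
    rw [eq_comm, Set.ncard_eq_zero (finite_firstHitWalks ..), Set.eq_empty_iff_forall_notMem]
    rintro p ⟨hp, -, h, -⟩
    rw [List.length_eq_zero_iff] at hp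
    subst hp
    exact hne i (by simpa using h)
  · congr 1
    ext p
    simp only [firstHitWalks, Set.mem_ofPred_eq, IsWalkFrom]
    constructor
    · rintro ⟨h1, h2, h3, h4, h5⟩
      exact ⟨h1, ⟨h2, by cases p <;> simp_all⟩, h4, (unique_occurrence_iff hne hred h4).1 h5⟩
    · rintro ⟨h1, ⟨h2, h3⟩, h4, h5⟩
      refine ⟨h1, h2, ?_, h4, (unique_occurrence_iff hne hred h4).2 h5⟩
      cases p with
      | nil => simp at h1; omega
      | cons e p => simpa using h3

theorem isWalkFrom_append_singleton (v : Fin N) (p : List (MatEdge A))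
    (e : MatEdge A) :
    IsWalkFrom v (p ++ [e]) ↔ IsWalkFrom v p ∧ eSrc e = wTgt v p := by
  rw [isWalkFrom_append]
  simp [IsWalkFrom, isMatWalk_iff_isChain]

/-- The walks from `v` to `i` of length `n + 1` avoiding `ws` except possibly at their last
edge. -/
def extendedWalks (A : Matrix (Fin N) (Fin N) ℕ) (v : Fin N) (ws : Fin k → List (MatEdge A))
    (n : ℕ) (i : Fin N) : Set (List (MatEdge A)) :=
  {p | p.length = n + 1 ∧ IsWalkFrom v p ∧ wTgt v p = i ∧ Avoids ws p.dropLast}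

theorem ncard_extendedWalks_eq_sum_avoidingWalks (v : Fin N) (ws : Fin k → List (MatEdge A))
    (n : ℕ) (i : Fin N) :
    (extendedWalks A v ws n i).ncard = ∑ j, A j i * (avoidingWalks A v ws n j).ncard := by
  have hfin (j : Fin N) : Finite (avoidingWalks A v ws n j) := finite_avoidingWalks v ws n j
  have hfin' (j : Fin N) : Finite (Fin (A j i) × avoidingWalks A v ws n j) := inferInstance
  let φ : (Σ j, Fin (A j i) × avoidingWalks A v ws n j) → extendedWalks A v ws n i :=
    fun x => ⟨x.2.2.1 ++ [matEdge x.2.1], by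
      obtain ⟨j, a, p, hp1, hp2, hp3, hp4⟩ := x
      refine ⟨by simp [hp1], ?_, ?_, by simpa using hp4⟩
      · exact (isWalkFrom_append_singleton ..).2 ⟨hp2, hp3.symm⟩
      · simp [wTgt]⟩
  have hφ : φ.Bijective := by
    constructor
    · rintro ⟨j, a, p, hp⟩ ⟨j', a', p', hp'⟩ h
      have h := congrArg Subtype.val h
      simp only [φ] at h
      obtain ⟨rfl, h2⟩ := List.append_inj' h rfl
      have h2 := List.singleton_injective h2
      unfold matEdge MatEdge at h2
      cases h2
      rfl
    · rintro ⟨q, hq1, hq2, hq3, hq4⟩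
      rcases q.eq_nil_or_concat' with rfl | ⟨p, e, rfl⟩
      · simp at hq1
      · obtain ⟨j, i', a, rfl⟩ := exists_eq_matEdge e
        obtain rfl : i' = i := by simpa [wTgt] using hq3
        rw [isWalkFrom_append_singleton] at hq2
        exact ⟨⟨j, a, p, by simpa using hq1, hq2.1, hq2.2.symm, by simpa using hq4⟩, rfl⟩
  rw [← Nat.card_coe_set_eq, ← Nat.card_eq_of_bijective φ hφ, Nat.card_sigma]
  simp [Nat.card_prod, Nat.card_coe_set_eq]

theorem wTgt_of_suffix (v : Fin N) {w p : List (MatEdge A)} (hw : w ≠ []) (h : w <:+ p) :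
    wTgt v p = wTgt v w := by
  obtain ⟨r, rfl⟩ := h
  rcases w.eq_nil_or_concat' with rfl | ⟨r, e, rfl⟩
  · exact absurd rfl hw
  · simp [wTgt, ← List.append_assoc]

theorem suffix_of_infix_of_avoids_dropLast {α : Type*} {ws : Fin k → List α} {p : List α}
    (hp : Avoids ws p.dropLast) {j : Fin k} (hj : ws j <:+: p) : ws j <:+ p := by
  rcases p.eq_nil_or_concat' with rfl | ⟨r, e, rfl⟩
  · rw [List.infix_nil] at hj
    simp [hj]
  · rcases List.infix_concat_iff.1 hj with h | h
    · exact h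
    · exact absurd h (by simpa using hp j)

theorem ncard_extendedWalks_eq_add (v : Fin N) {ws : Fin k → List (MatEdge A)}
    (hne : ∀ i, ws i ≠ []) (hred : ∀ i j : Fin k, i ≠ j → ¬ ws i <:+: ws j)
    (n : ℕ) (i : Fin N) :
    (extendedWalks A v ws n i).ncard = (avoidingWalks A v ws (n + 1) i).ncard +
      ∑ j, if i = wTgt v (ws j) then (firstHitWalks A v ws (n + 1) j).ncard else 0 := by
  have hunion : extendedWalks A v ws n i = avoidingWalks A v ws (n + 1) i ∪
      ⋃ j, {p | p ∈ firstHitWalks A v ws (n + 1) j ∧ i = wTgt v (ws j)} := by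
    ext p
    simp only [extendedWalks, avoidingWalks, firstHitWalks, Set.mem_ofPred_eq, Set.mem_union,
      Set.mem_iUnion]
    constructor
    · rintro ⟨h1, h2, h3, h4⟩
      by_cases h : Avoids ws p
      · exact Or.inl ⟨h1, h2, h3, h⟩
      · obtain ⟨j, hj⟩ : ∃ j, ws j <:+: p := by simpa [Avoids] using h
        have hj := suffix_of_infix_of_avoids_dropLast h4 hj
        exact Or.inr ⟨j, ⟨h1, h2, hj, h4⟩, by rw [← h3, wTgt_of_suffix v (hne j) hj]⟩
    · rintro (⟨h1, h2, h3, h4⟩ | ⟨j, ⟨h1, h2, h3, h4⟩, h⟩)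
      · exact ⟨h1, h2, h3, h4.of_infix (List.dropLast_prefix p).isInfix⟩
      · exact ⟨h1, h2, by rw [h, wTgt_of_suffix v (hne j) h3], h4⟩
  have hfin (j : Fin k) :
      {p | p ∈ firstHitWalks A v ws (n + 1) j ∧ i = wTgt v (ws j)}.Finite :=
    (finite_firstHitWalks v ws (n + 1) j).subset fun _ hp => hp.1
  have hdisj : Disjoint (avoidingWalks A v ws (n + 1) i)
      (⋃ j, {p | p ∈ firstHitWalks A v ws (n + 1) j ∧ i = wTgt v (ws j)}) := by
    rw [Set.disjoint_iUnion_right]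
    refine fun j => Set.disjoint_left.2 ?_
    rintro p ⟨-, -, -, h⟩ ⟨⟨-, -, h', -⟩, -⟩
    exact h j h'.isInfix
  rw [hunion, Set.ncard_union_eq hdisj (finite_avoidingWalks ..) (Set.finite_iUnion hfin),
    Set.ncard_iUnion_of_finite hfin, finsum_eq_sum_of_fintype]
  · congr 1
    refine Finset.sum_congr rfl fun j _ => ?_
    split_ifs with h <;> simp [h]
  · intro j j' hj
    refine Set.disjoint_left.2 ?_
    rintro p ⟨⟨-, -, h, -⟩, -⟩ ⟨⟨-, -, h', -⟩, -⟩
    exact hj (eq_of_suffix_of_suffix hred h h')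

theorem corrIdx_iff {α : Type*} {u w : List α} (h : w <:+: u → u = w) (ℓ : ℕ) :
    corrIdx u w ℓ ↔ ℓ + 1 ≤ w.length ∧ w.take (ℓ + 1) <:+ u := by
  constructor
  · rintro ⟨hlu, hl⟩
    have hlw : ℓ + 1 ≤ w.length := by
      by_contra hlw
      have hpre : w <+: u.drop (u.length - 1 - ℓ) := by
        rw [List.prefix_iff_getElem?]
        intro j hj
        rw [List.getElem?_drop, hl j (by omega) hj, List.getElem?_eq_getElem hj]
      have := h (hpre.isInfix.trans (List.drop_suffix _ _).isInfix)
      subst this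
      omega
    refine ⟨hlw, ?_⟩
    have : w.take (ℓ + 1) = u.drop (u.length - 1 - ℓ) := by
      refine List.ext_getElem? fun j => ?_
      rw [List.getElem?_drop, List.getElem?_take]
      split_ifs with hj
      · exact (hl j (by omega) (by omega)).symm
      · rw [List.getElem?_eq_none (by omega)]
    rw [this]
    exact List.drop_suffix _ _
  · rintro ⟨hlw, s, hs⟩
    have hlen := congrArg List.length hs
    rw [List.length_append, List.length_take, min_eq_left hlw] at hlen
    refine ⟨by omega, fun j hj _ => ?_⟩
    rw [← hs, List.getElem?_append_right (by rw [hs]; omega), List.getElem?_take, if_pos]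
    · congr 1
      rw [hs]; omega
    · rw [hs]; omega

theorem lt_length_of_mem_corrFinset {α : Type*} {u w : List α} {ℓ : ℕ}
    (h : ℓ ∈ corrFinset u w) : ℓ < u.length := by
  simp only [corrFinset, Finset.mem_filter, Finset.mem_range] at h
  exact h.1

theorem mem_corrFinset_iff {α : Type*} {ws : Fin k → List α}
    (hred : ∀ i j : Fin k, i ≠ j → ¬ ws i <:+: ws j) {i j : Fin k} {ℓ : ℕ} :
    ℓ ∈ corrFinset (ws j) (ws i) ↔
      ℓ + 1 ≤ (ws i).length ∧ (ws i).take (ℓ + 1) <:+ ws j := by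
  rw [← corrIdx_iff (fun h => by
    by_contra hij
    exact hred i j (fun e => hij (by rw [e])) h)]
  simp only [corrFinset, Finset.mem_filter, Finset.mem_range]
  exact ⟨fun h => h.2, fun h => ⟨h.1, h⟩⟩

theorem dropLast_append_take_succ {α : Type*} (p : List α) {w : List α} {ℓ : ℕ}
    (h : ℓ + 1 ≤ w.length) : (p ++ w.take (ℓ + 1)).dropLast = p ++ w.take ℓ := by
  rw [List.take_succ_eq_append_getElem (by omega), ← List.append_assoc, List.dropLast_concat]

theorem exists_first_hit {α : Type*} {ws : Fin k → List α} {p w : List α} (hp : Avoids ws p)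
    (hw : ¬ Avoids ws (p ++ w)) :
    ∃ (ℓ : ℕ) (j : Fin k), ℓ + 1 ≤ w.length ∧ ws j <:+ p ++ w.take (ℓ + 1) ∧
      Avoids ws (p ++ w.take ℓ) := by
  classical
  have hex : ∃ m, ¬ Avoids ws (p ++ w.take m) := ⟨w.length, by simpa using hw⟩
  have hspec := Nat.find_spec hex
  have hmin := fun m => Nat.find_min hex (m := m)
  obtain ⟨ℓ, hl⟩ : ∃ ℓ, Nat.find hex = ℓ + 1 :=
    Nat.exists_eq_succ_of_ne_zero fun h0 => hspec (by simpa [h0] using hp)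
  rw [hl] at hspec hmin
  have hprev : Avoids ws (p ++ w.take ℓ) := not_not.1 (hmin ℓ (by omega))
  have hlw : ℓ + 1 ≤ w.length := by
    by_contra hlw
    rw [List.take_of_length_le (by omega)] at hspec hprev
    exact hspec hprev
  obtain ⟨j, hj⟩ : ∃ j, ws j <:+: p ++ w.take (ℓ + 1) := by simpa [Avoids] using hspec
  refine ⟨ℓ, j, hlw, suffix_of_infix_of_avoids_dropLast ?_ hj, hprev⟩
  rw [dropLast_append_take_succ p hlw]
  exact hprev

theorem ncard_avoidingWalks_wSrc (v : Fin N) {ws : Fin k → List (MatEdge A)}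
    (hwalk : ∀ i, ws i ≠ [] ∧ IsMatWalk A (ws i))
    (hred : ∀ i j : Fin k, i ≠ j → ¬ ws i <:+: ws j) (n : ℕ) (i : Fin k) :
    (avoidingWalks A v ws n (wSrc v (ws i))).ncard =
      ∑ j, ∑ ℓ ∈ corrFinset (ws j) (ws i), (firstHitWalks A v ws (n + ℓ + 1) j).ncard := by
  have hfin (j : Fin k) (ℓ : ℕ) : Finite (firstHitWalks A v ws (n + ℓ + 1) j) :=
    finite_firstHitWalks ..
  have hwsrc : IsWalkFrom (wSrc v (ws i)) (ws i) := by
    refine ⟨(hwalk i).2, ?_⟩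
    rintro e he
    simp [wSrc, Option.mem_def.1 he]
  -- a first-hit walk splits into its first `n` edges and an initial segment of `ws i`
  have hsplit {j : Fin k} {ℓ : ℕ} (hl : ℓ ∈ corrFinset (ws j) (ws i)) {q : List (MatEdge A)}
      (hq : q ∈ firstHitWalks A v ws (n + ℓ + 1) j) :
      q.take n ++ (ws i).take (ℓ + 1) = q := by
    obtain ⟨hl1, hl2⟩ := (mem_corrFinset_iff hred).1 hl
    obtain ⟨s, hs⟩ := hl2.trans hq.2.2.1
    have := congrArg List.length hs
    rw [hq.1, List.length_append, List.length_take, min_eq_left hl1] at this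
    conv_lhs => rw [← hs]
    rw [List.take_left' (by omega), hs]
  let φ : (Σ j, Σ ℓ : corrFinset (ws j) (ws i), firstHitWalks A v ws (n + ℓ + 1) j) →
      avoidingWalks A v ws n (wSrc v (ws i)) :=
    fun x => ⟨x.2.2.1.take n, by
      obtain ⟨j, ⟨ℓ, hl⟩, q, hq⟩ := x
      have hs := hsplit hl hq
      obtain ⟨hq1, hq2, hq3, hq4⟩ := hq
      have hl1 := ((mem_corrFinset_iff hred).1 hl).1
      rw [← hs, isWalkFrom_append] at hq2
      refine ⟨by simp [hq1]; omega, hq2.1, ?_, hq4.of_infix ?_⟩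
      · obtain ⟨e, r, hr⟩ := List.exists_cons_of_ne_nil (hwalk i).1
        have := hq2.2.2 e (by simp [hr])
        simp [wSrc, hr, this]
      · have : q.take n <+: q.dropLast := by
          rw [List.dropLast_eq_take, hq1]
          exact List.take_prefix_take_left (by omega)
        exact this.isInfix⟩
  have hφ : φ.Bijective := by
    constructor
    · rintro ⟨j, ⟨ℓ, hl⟩, q, hq⟩ ⟨j', ⟨ℓ', hl'⟩, q', hq'⟩ hφ
      have htake : q.take n = q'.take n := congrArg Subtype.val hφ
      have key {j j' : Fin k} {ℓ ℓ' : ℕ} {q q' : List (MatEdge A)}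
          (hl : ℓ ∈ corrFinset (ws j) (ws i)) (hl' : ℓ' ∈ corrFinset (ws j') (ws i))
          (hq : q ∈ firstHitWalks A v ws (n + ℓ + 1) j)
          (hq' : q' ∈ firstHitWalks A v ws (n + ℓ' + 1) j')
          (h : q.take n = q'.take n) : ℓ' ≤ ℓ := by
        by_contra! hlt
        have hl1 := ((mem_corrFinset_iff hred).1 hl').1
        refine hq'.2.2.2 j (hq.2.2.1.isInfix.trans ?_)
        rw [← hsplit hl hq, ← hsplit hl' hq', ← h, dropLast_append_take_succ _ hl1]
        exact ((List.prefix_append_right_inj _).2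
          (List.take_prefix_take_left (by omega))).isInfix
      obtain rfl : ℓ = ℓ' := le_antisymm
        (key hl' hl hq' hq htake.symm) (key hl hl' hq hq' htake)
      obtain rfl : q = q' := by rw [← hsplit hl hq, ← hsplit hl' hq', htake]
      obtain rfl : j = j' := eq_of_suffix_of_suffix hred hq.2.2.1 hq'.2.2.1
      rfl
    · rintro ⟨p, hp1, hp2, hp3, hp4⟩
      obtain ⟨ℓ, j, hl, hsuf, hav⟩ := exists_first_hit (w := ws i) hp4
        (fun h => h i (List.suffix_append _ _).isInfix)
      have hlc : ℓ ∈ corrFinset (ws j) (ws i) := by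
        refine (mem_corrFinset_iff hred).2 ⟨hl, ?_⟩
        rcases List.suffix_or_suffix_of_suffix hsuf (List.suffix_append _ _) with h | h
        · have hij : j = i := by
            by_contra hij
            exact hred j i hij (h.isInfix.trans (List.take_prefix _ _).isInfix)
          subst hij
          have := h.length_le
          rw [List.take_of_length_le (by simp at this; omega)]
        · exact h
      refine ⟨⟨j, ⟨ℓ, hlc⟩, p ++ (ws i).take (ℓ + 1), ?_, ?_, hsuf, ?_⟩, ?_⟩
      · simp [hp1]; omega
      · have := (isWalkFrom_append v p (ws i)).2 ⟨hp2, by rw [hp3]; exact hwsrc⟩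
        rw [← List.take_append_drop (ℓ + 1) (ws i), ← List.append_assoc,
          isWalkFrom_append] at this
        exact this.1
      · rw [dropLast_append_take_succ p hl]
        exact hav
      · exact Subtype.ext (List.take_left' hp1)
  rw [← Nat.card_coe_set_eq, ← Nat.card_eq_of_bijective φ hφ, Nat.card_sigma]
  refine Finset.sum_congr rfl fun j _ => ?_
  rw [Nat.card_sigma, ← Finset.sum_coe_sort (corrFinset (ws j) (ws i))]
  rfl

theorem sum_mul_fW (v : Fin N) {ws : Fin k → List (MatEdge A)}
    (hne : ∀ i, ws i ≠ []) (hred : ∀ i j : Fin k, i ≠ j → ¬ ws i <:+: ws j)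
    (n : ℕ) (i : Fin N) :
    ∑ j, A j i * fW A v ws n j =
      fW A v ws (n + 1) i + ∑ j, if i = wTgt v (ws j) then gW A v ws (n + 1) j else 0 := by
  simp only [fW_eq_ncard v hne, gW_eq_ncard v hne hred]
  rw [← ncard_extendedWalks_eq_sum_avoidingWalks, ncard_extendedWalks_eq_add v hne hred]

theorem fW_wSrc (v : Fin N) {ws : Fin k → List (MatEdge A)}
    (hwalk : ∀ i, ws i ≠ [] ∧ IsMatWalk A (ws i))
    (hred : ∀ i j : Fin k, i ≠ j → ¬ ws i <:+: ws j) (n : ℕ) (i : Fin k) :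
    fW A v ws n (wSrc v (ws i)) =
      ∑ j, ∑ ℓ ∈ corrFinset (ws j) (ws i), gW A v ws (n + ℓ + 1) j := by
  have hne := fun i => (hwalk i).1
  simp only [fW_eq_ncard v hne, gW_eq_ncard v hne hred]
  exact ncard_avoidingWalks_wSrc v hwalk hred n i

theorem gW_eq_zero_of_lt (v : Fin N) {ws : Fin k → List (MatEdge A)}
    (hne : ∀ i, ws i ≠ []) (hred : ∀ i j : Fin k, i ≠ j → ¬ ws i <:+: ws j)
    {n : ℕ} {i : Fin k} (hn : n < (ws i).length) : gW A v ws n i = 0 := by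
  rw [gW_eq_ncard v hne hred, Set.ncard_eq_zero (finite_firstHitWalks ..),
    Set.eq_empty_iff_forall_notMem]
  rintro p ⟨hp, -, h, -⟩
  have := h.length_le
  omega

theorem eigenvalue_nonneg {v₀ : Fin N} {lam : ℝ} {u : Fin N → ℝ} (hu : ∀ i, 0 < u i)
    (hlam : (A.map (Nat.cast : ℕ → ℝ)) *ᵥ u = lam • u) : 0 ≤ lam := by
  have h := congrFun hlam v₀
  have hnn : 0 ≤ lam * u v₀ := by
    rw [← smul_eq_mul, ← Pi.smul_apply, ← h]
    exact dotProduct_nonneg_of_nonneg (fun j => by simp) fun j => (hu j).le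
  exact nonneg_of_mul_nonneg_left hnn (hu v₀)

theorem sum_fW_mul_le (v : Fin N) {ws : Fin k → List (MatEdge A)}
    (hne : ∀ i, ws i ≠ []) (hred : ∀ i j : Fin k, i ≠ j → ¬ ws i <:+: ws j)
    {lam : ℝ} {u : Fin N → ℝ} (hu : ∀ i, 0 < u i)
    (hlam : (A.map (Nat.cast : ℕ → ℝ)) *ᵥ u = lam • u) (n : ℕ) :
    ∑ i, (fW A v ws n i : ℝ) * u i ≤ lam ^ n * u v := by
  induction n with
  | zero => simp [fW]
  | succ n ih =>
    calc ∑ i, (fW A v ws (n + 1) i : ℝ) * u i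
        ≤ ∑ i, (∑ j, (A j i : ℝ) * fW A v ws n j) * u i := by
          refine Finset.sum_le_sum fun i _ => mul_le_mul_of_nonneg_right ?_ (hu i).le
          exact_mod_cast (Nat.le_add_right _ _).trans (sum_mul_fW v hne hred n i).ge
      _ = ∑ j, (fW A v ws n j : ℝ) * ((A.map (Nat.cast : ℕ → ℝ)) *ᵥ u) j := by
          simp only [Matrix.mulVec, dotProduct, Finset.sum_mul, Finset.mul_sum, Matrix.map_apply]
          rw [Finset.sum_comm]
          exact Finset.sum_congr rfl fun _ _ => Finset.sum_congr rfl fun _ _ => by ring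
      _ = lam * ∑ j, (fW A v ws n j : ℝ) * u j := by
          rw [hlam, Finset.mul_sum]
          exact Finset.sum_congr rfl fun _ _ => by simp; ring
      _ ≤ lam ^ (n + 1) * u v := by
          rw [pow_succ', mul_assoc]
          exact mul_le_mul_of_nonneg_left ih (eigenvalue_nonneg (v₀ := v) hu hlam)

theorem summable_fW (v : Fin N) {ws : Fin k → List (MatEdge A)}
    (hne : ∀ i, ws i ≠ []) (hred : ∀ i j : Fin k, i ≠ j → ¬ ws i <:+: ws j)
    {lam : ℝ} {u : Fin N → ℝ} (hu : ∀ i, 0 < u i)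
    (hlam : (A.map (Nat.cast : ℕ → ℝ)) *ᵥ u = lam • u) {z : ℝ} (hz : lam < z) (i : Fin N) :
    Summable fun n : ℕ => (fW A v ws n i : ℝ) / z ^ n := by
  have hlam0 := eigenvalue_nonneg (v₀ := v) hu hlam
  have hz0 : 0 < z := hlam0.trans_lt hz
  refine Summable.of_nonneg_of_le (fun n => by positivity) (fun n => ?_)
    ((summable_geometric_of_lt_one (by positivity : 0 ≤ lam / z)
      ((div_lt_one hz0).2 hz)).mul_left (u v / u i))
  have h1 : (fW A v ws n i : ℝ) * u i ≤ lam ^ n * u v :=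
    (Finset.single_le_sum (f := fun i => (fW A v ws n i : ℝ) * u i)
      (fun i _ => mul_nonneg (Nat.cast_nonneg _) (hu i).le) (Finset.mem_univ i)).trans
      (sum_fW_mul_le v hne hred hu hlam n)
  have h2 : (fW A v ws n i : ℝ) ≤ lam ^ n * u v / u i := (le_div_iff₀ (hu i)).2 h1
  calc (fW A v ws n i : ℝ) / z ^ n ≤ lam ^ n * u v / u i / z ^ n := by gcongr
    _ = u v / u i * (lam / z) ^ n := by rw [div_pow]; ring

theorem summable_gW (v : Fin N) {ws : Fin k → List (MatEdge A)}
    (hne : ∀ i, ws i ≠ []) (hred : ∀ i j : Fin k, i ≠ j → ¬ ws i <:+: ws j)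
    {z : ℝ} (hz : 0 < z) (hF : ∀ i, Summable fun n : ℕ => (fW A v ws n i : ℝ) / z ^ n)
    (i : Fin k) : Summable fun n : ℕ => (gW A v ws n i : ℝ) / z ^ n := by
  refine (summable_nat_add_iff 1).1 ?_
  refine Summable.of_nonneg_of_le (fun n => by positivity) (fun n => ?_)
    ((summable_sum fun j (_ : j ∈ Finset.univ) =>
      (hF j).mul_left (A j (wTgt v (ws i)) : ℝ)).mul_left z⁻¹)
  have h : gW A v ws (n + 1) i ≤ ∑ j, A j (wTgt v (ws i)) * fW A v ws n j := by
    rw [sum_mul_fW v hne hred]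
    refine le_add_of_nonneg_of_le (Nat.zero_le _) ?_
    refine le_trans ?_ (Finset.single_le_sum (fun _ _ => Nat.zero_le _) (Finset.mem_univ i))
    simp
  have h : (gW A v ws (n + 1) i : ℝ) ≤ ∑ j, (A j (wTgt v (ws i)) : ℝ) * fW A v ws n j := by
    exact_mod_cast h
  calc (gW A v ws (n + 1) i : ℝ) / z ^ (n + 1)
      ≤ (∑ j, (A j (wTgt v (ws i)) : ℝ) * fW A v ws n j) / z ^ (n + 1) := by gcongr
    _ = z⁻¹ * ∑ j, (A j (wTgt v (ws i)) : ℝ) * (fW A v ws n j / z ^ n) := by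
      simp only [← mul_div_assoc]
      rw [← Finset.sum_div, pow_succ]
      field_simp

theorem hasSum_shift_div_pow {z : ℝ} (hz : z ≠ 0) {a : ℕ → ℝ} {S : ℝ}
    (h : HasSum (fun n => a n / z ^ n) S) (r : ℕ) :
    HasSum (fun n => a (n + r) / z ^ n) (z ^ r * (S - ∑ m ∈ Finset.range r, a m / z ^ m)) := by
  have h1 : HasSum (fun n => a (n + r) / z ^ (n + r)) (S - ∑ m ∈ Finset.range r, a m / z ^ m) := by
    refine (hasSum_nat_add_iff (f := fun n => a n / z ^ n) r).2 ?_
    rwa [sub_add_cancel]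
  have h2 (n : ℕ) : a (n + r) / z ^ n = z ^ r * (a (n + r) / z ^ (n + r)) := by
    rw [pow_add]
    field_simp
  simpa only [h2] using h1.mul_left (z ^ r)

theorem Pmat_mulVec_generatingFunctions (v : Fin N) {ws : Fin k → List (MatEdge A)}
    (hwalk : ∀ i, ws i ≠ [] ∧ IsMatWalk A (ws i))
    (hred : ∀ i j : Fin k, i ≠ j → ¬ ws i <:+: ws j) {z : ℝ} (hz : z ≠ 0)
    {F : Fin N → ℝ} {G : Fin k → ℝ}
    (hF : ∀ i, HasSum (fun n : ℕ => (fW A v ws n i : ℝ) / z ^ n) (F i))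
    (hG : ∀ i, HasSum (fun n : ℕ => (gW A v ws n i : ℝ) / z ^ n) (G i)) :
    Pmat A v ws z *ᵥ Sum.elim F G = fun i => if i = Sum.inl v then z else 0 := by
  have hne := fun i => (hwalk i).1
  rw [Pmat, Matrix.fromBlocks_mulVec]
  ext (i | i)
  · have h1 : HasSum (fun n : ℕ => ∑ j, (A j i : ℝ) * (fW A v ws n j / z ^ n))
        (∑ j, (A j i : ℝ) * F j) := hasSum_sum fun j _ => (hF j).mul_left _
    have h2 : HasSum (fun n : ℕ => ∑ j, (A j i : ℝ) * (fW A v ws n j / z ^ n))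
        (z * (F i - if i = v then 1 else 0) +
          ∑ j, (if i = wTgt v (ws j) then z else 0) * G j) := by
      have hf := hasSum_shift_div_pow hz (hF i) 1
      have hg : HasSum (fun n : ℕ => ∑ j, (if i = wTgt v (ws j) then (1 : ℝ) else 0) *
          (gW A v ws (n + 1) j / z ^ n))
          (∑ j, (if i = wTgt v (ws j) then (1 : ℝ) else 0) * (z * G j)) := by
        refine hasSum_sum fun j _ => HasSum.mul_left _ ?_
        simpa [gW] using hasSum_shift_div_pow hz (hG j) 1
      convert hf.add hg using 1
      · ext n
        have := congrArg (Nat.cast : ℕ → ℝ) (sum_mul_fW v hne hred n i)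
        push_cast at this
        simp only [← mul_div_assoc, ← Finset.sum_div, ← add_div, this]
        simp
      · simp [fW]
    have h := h1.unique h2
    simp only [Sum.elim_inl, Pi.add_apply, Matrix.mulVec, dotProduct, Function.comp_apply,
      Matrix.sub_apply, Matrix.smul_apply, Matrix.one_apply, Matrix.transpose_apply,
      Matrix.map_apply, Sum.elim_inr, Matrix.of_apply, sub_mul, Finset.sum_sub_distrib, h]
    simp
    split_ifs <;> ring
  · have h1 := hF (wSrc v (ws i))
    have h2 : HasSum (fun n : ℕ => (fW A v ws n (wSrc v (ws i)) : ℝ) / z ^ n)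
        (∑ j, ∑ ℓ ∈ corrFinset (ws j) (ws i), z ^ (ℓ + 1) * G j) := by
      simp only [fW_wSrc v hwalk hred, Nat.cast_sum, Finset.sum_div]
      refine hasSum_sum fun j _ => hasSum_sum fun ℓ hl => ?_
      have hl' : ℓ < (ws j).length := lt_length_of_mem_corrFinset hl
      have h := hasSum_shift_div_pow hz (hG j) (ℓ + 1)
      rw [Finset.sum_eq_zero, sub_zero] at h
      · exact h
      · intro m hm
        rw [gW_eq_zero_of_lt v hne hred (by rw [Finset.mem_range] at hm; omega)]
        simp
    have h := h1.unique h2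
    simp only [Sum.elim_inl, Pi.add_apply, Matrix.mulVec, dotProduct, Function.comp_apply,
      Matrix.smul_apply, Matrix.neg_apply, corrPoly, Sum.elim_inr, Matrix.of_apply]
    simp [h, Finset.mul_sum, Finset.sum_mul, pow_succ']

theorem tendsto_inv_pow_mul_pow {m n : ℕ} (h : m ≤ n) :
    Tendsto (fun z : ℝ => (z ^ n)⁻¹ * z ^ m) atTop (𝓝 (if m = n then 1 else 0)) := by
  split_ifs with hmn
  · subst hmn
    refine tendsto_const_nhds.congr' ?_
    filter_upwards [eventually_ne_atTop 0] with z hz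
    field_simp
  · simpa [div_eq_inv_mul] using
      tendsto_pow_div_pow_atTop_zero (𝕜 := ℝ) (lt_of_le_of_ne h hmn)

theorem sum_corrFinset_ite_eq {α : Type*} {ws : Fin k → List α} (hne : ∀ i, ws i ≠ [])
    (hred : ∀ i j : Fin k, i ≠ j → ¬ ws i <:+: ws j) (i j : Fin k) :
    (∑ ℓ ∈ corrFinset (ws j) (ws i), if ℓ + 1 = (ws j).length then (1 : ℝ) else 0) =
      (1 : Matrix (Fin k) (Fin k) ℝ) i j := by
  have hpos := List.length_pos_iff.2 (hne j)
  rw [Matrix.one_apply]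
  split_ifs with hij
  · subst hij
    rw [Finset.sum_eq_single ((ws i).length - 1), if_pos (by omega)]
    · intro ℓ _ hl
      rw [if_neg (by omega)]
    · refine fun h => absurd ((mem_corrFinset_iff hred).2 ⟨by omega, ?_⟩) h
      rw [List.take_of_length_le (by omega)]
  · refine Finset.sum_eq_zero fun ℓ hl => if_neg fun hlen => ?_
    obtain ⟨hl1, hl2⟩ := (mem_corrFinset_iff hred).1 hl
    have := hl2.eq_of_length (by simp; omega)
    exact hred j i (Ne.symm hij) (this ▸ (List.take_prefix _ _).isInfix)

theorem eventually_isUnit_det_Pmat (v : Fin N) {ws : Fin k → List (MatEdge A)}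
    (hne : ∀ i, ws i ≠ []) (hred : ∀ i j : Fin k, i ≠ j → ¬ ws i <:+: ws j) :
    ∀ᶠ z : ℝ in atTop, IsUnit (Pmat A v ws z).det := by
  -- scaling the columns by powers of `z` makes the matrix converge to an invertible one
  let s (z : ℝ) : Fin N ⊕ Fin k → ℝ :=
    Sum.elim (fun _ => z⁻¹) fun j => (z ^ (ws j).length)⁻¹
  let L : Matrix (Fin N ⊕ Fin k) (Fin N ⊕ Fin k) ℝ := Matrix.fromBlocks 1
    (Matrix.of fun i j => if i = wTgt v (ws j) then (if 1 = (ws j).length then 1 else 0) else 0)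
    0 (-1)
  have hlim : Tendsto (fun z => Matrix.of fun i j => s z j * Pmat A v ws z i j) atTop (𝓝 L) := by
    refine tendsto_pi_nhds.2 fun i => tendsto_pi_nhds.2 fun j => ?_
    rcases i with i | i <;> rcases j with j | j
    · have h : Tendsto (fun z : ℝ => (1 : Matrix (Fin N) (Fin N) ℝ) i j - z⁻¹ * A j i) atTop
          (𝓝 ((1 : Matrix (Fin N) (Fin N) ℝ) i j - 0 * A j i)) :=
        tendsto_const_nhds.sub (tendsto_inv_atTop_zero.mul_const _)
      rw [zero_mul, sub_zero] at h
      refine h.congr' ?_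
      filter_upwards [eventually_ne_atTop 0] with z hz
      simp only [Matrix.of_apply, s, Pmat, Sum.elim_inl, Matrix.fromBlocks_apply₁₁,
        Matrix.sub_apply, Matrix.smul_apply, Matrix.transpose_apply, Matrix.map_apply, smul_eq_mul]
      field_simp
    · simp only [Matrix.of_apply, s, Pmat, Sum.elim_inr, Matrix.fromBlocks_apply₁₂, L]
      split_ifs with h1 h2
      · simpa [← h2] using tendsto_inv_pow_mul_pow (List.length_pos_iff.2 (hne j))
      · simpa [h2] using tendsto_inv_pow_mul_pow (List.length_pos_iff.2 (hne j))
      · simp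
    · simp only [Matrix.of_apply, s, Pmat, Sum.elim_inl, Matrix.fromBlocks_apply₂₁, L]
      simpa using tendsto_inv_atTop_zero.mul_const (if j = wSrc v (ws i) then (1 : ℝ) else 0)
    · have h : Tendsto (fun z : ℝ => -∑ ℓ ∈ corrFinset (ws j) (ws i),
          (z ^ (ws j).length)⁻¹ * z ^ (ℓ + 1)) atTop
          (𝓝 (-∑ ℓ ∈ corrFinset (ws j) (ws i), if ℓ + 1 = (ws j).length then (1 : ℝ) else 0)) := by
        refine (tendsto_finsetSum _ fun ℓ hl => tendsto_inv_pow_mul_pow ?_).neg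
        exact lt_length_of_mem_corrFinset hl
      rw [sum_corrFinset_ite_eq hne hred] at h
      refine h.congr fun z => ?_
      simp [s, Pmat, corrPoly, Finset.mul_sum, pow_succ']
  have hL : L.det ≠ 0 := by
    simp [L, Matrix.det_fromBlocks_zero₂₁, Matrix.det_neg]
  have hdet := ((continuous_id.matrix_det).tendsto L).comp hlim
  filter_upwards [hdet.eventually_ne hL] with z hz
  simp only [Function.comp_apply, id, Matrix.det_mul_row] at hz
  exact isUnit_iff_ne_zero.2 (right_ne_zero_of_mul hz)

end

/-- Multi-word perturbations of an irreducible SFT: the generating functions of the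
counting sequences satisfy the linear system `P(z) (F, G)ᵀ = (z, 0, …, 0)ᵀ` for `z > λ_A`,
and for all sufficiently large `z`, `P(z)` is invertible and
`Σ f(n) z^{−n} = z Σ_i (P(z)⁻¹)_{i,v₀}`. -/
theorem sft_multiword_generating_function (N k : ℕ) (A : Matrix (Fin N) (Fin N) ℕ)
    (hA : ∀ i j : Fin N, ∃ n : ℕ, 0 < (A ^ n) i j) (v₀ : Fin N)
    (lamA : ℝ)
    (hlamA : ∃ v : Fin N → ℝ, (∀ i, 0 < v i) ∧
      (A.map (Nat.cast : ℕ → ℝ)) *ᵥ v = lamA • v)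
    (ws : Fin k → List (MatEdge A))
    (hwalk : ∀ i, ws i ≠ [] ∧ IsMatWalk A (ws i))
    (hred : ∀ i j : Fin k, i ≠ j → ¬ ws i <:+: ws j) :
    (∀ z : ℝ, lamA < z →
      (∀ i : Fin N, Summable fun n : ℕ => (fW A v₀ ws n i : ℝ) / z ^ n) ∧
      (∀ i : Fin k, Summable fun n : ℕ => (gW A v₀ ws n i : ℝ) / z ^ n) ∧
      Pmat A v₀ ws z *ᵥ
          Sum.elim (fun i : Fin N => ∑' n : ℕ, (fW A v₀ ws n i : ℝ) / z ^ n)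
            (fun i : Fin k => ∑' n : ℕ, (gW A v₀ ws n i : ℝ) / z ^ n) =
        fun i => if i = Sum.inl v₀ then z else 0) ∧
    (∃ Z₀ : ℝ, ∀ z : ℝ, Z₀ < z →
      IsUnit (Pmat A v₀ ws z).det ∧
      ∑' n : ℕ, ((∑ i : Fin N, fW A v₀ ws n i : ℕ) : ℝ) / z ^ n =
        z * ∑ i : Fin N, (Pmat A v₀ ws z)⁻¹ (Sum.inl i) (Sum.inl v₀)) := by
  obtain ⟨u, hu, hlam⟩ := hlamA
  have hne := fun i => (hwalk i).1
  have hpos {z : ℝ} (hz : lamA < z) : 0 < z := (eigenvalue_nonneg (v₀ := v₀) hu hlam).trans_lt hz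
  have hF {z : ℝ} (hz : lamA < z) (i : Fin N) := summable_fW v₀ hne hred hu hlam hz i
  have hG {z : ℝ} (hz : lamA < z) (i : Fin k) :=
    summable_gW v₀ hne hred (hpos hz) (fun i => hF hz i) i
  have hP {z : ℝ} (hz : lamA < z) := Pmat_mulVec_generatingFunctions v₀ hwalk hred (hpos hz).ne'
    (fun i => (hF hz i).hasSum) (fun i => (hG hz i).hasSum)
  refine ⟨fun z hz => ⟨hF hz, hG hz, hP hz⟩, ?_⟩
  obtain ⟨Z, hZ⟩ := eventually_atTop.1 (eventually_isUnit_det_Pmat (A := A) v₀ hne hred)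
  refine ⟨max Z lamA, fun z hz => ?_⟩
  have hdet := hZ z ((le_max_left _ _).trans hz.le)
  have hz := (le_max_right _ _).trans_lt hz
  refine ⟨hdet, ?_⟩
  have hsol := congrArg ((Pmat A v₀ ws z)⁻¹ *ᵥ ·) (hP hz)
  simp only [Matrix.mulVec_mulVec, Matrix.nonsing_inv_mul _ hdet, Matrix.one_mulVec] at hsol
  simp only [Nat.cast_sum, Finset.sum_div]
  rw [Summable.tsum_finsetSum fun i _ => hF hz i, Finset.mul_sum]
  refine Finset.sum_congr rfl fun i _ => ?_
  have h := congrFun hsol (Sum.inl i)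
  rw [Sum.elim_inl] at h
  rw [h]
  simp [Matrix.mulVec, dotProduct, mul_comm]
end

section
/- Let A be a finite alphabet, x ∈ A^ℕ, and for n ≥ 1 let w_n = x_1⋯x_n be the length-n prefix of x. Then for every real z > 1: lim_{n→∞} z^{−(n−1)} (w_n, w_n)_z = 1 if x is not periodic, and lim_{n→∞} z^{−(n−1)} (w_n, w_n)_z = 1/(1 − z^{−s}) if x is periodic with least period s. -/
open Filter Topology

/-- The length-`n` prefix `x_1 ⋯ x_n` of a one-sided sequence. -/
def prefixWord {A : Type*} (x : ℕ → A) (n : ℕ) : List A := (List.range n).map x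

theorem corrIdx_prefixWord_iff {A : Type*} (x : ℕ → A) {n k : ℕ} (hk : k < n) :
    corrIdx (prefixWord x n) (prefixWord x n) (n - 1 - k) ↔ ∀ j, j + k < n → x (j + k) = x j := by
  simp only [corrIdx, prefixWord, List.length_map, List.length_range]
  have hshift : n - 1 - (n - 1 - k) = k := by omega
  rw [hshift]
  constructor
  · rintro ⟨-, h⟩ j hj
    have hjn : j < n := by omega
    have hkj : j + k < n := by omega
    have := h j (by omega) hjn
    simpa [List.getElem?_range hjn, List.getElem?_range hkj, add_comm k j] using this
  · intro h
    refine ⟨by omega, fun j hj hjn => ?_⟩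
    have hkj : j + k < n := by omega
    have := h j (by omega)
    simpa [List.getElem?_range hjn, List.getElem?_range hkj, add_comm k j] using this

open scoped Classical in
theorem corrPoly_prefixWord_div_eq_tsum {A : Type*} (x : ℕ → A) {z : ℝ} (hz : z ≠ 0) (n : ℕ) :
    corrPoly (prefixWord x n) (prefixWord x n) z / z ^ (n - 1) =
      ∑' k, if k < n ∧ ∀ j, j + k < n → x (j + k) = x j then z⁻¹ ^ k else 0 := by
  rw [tsum_eq_sum (s := Finset.range n)
    (fun k hk => if_neg fun h => hk (Finset.mem_range.2 h.1))]
  have hlen : (prefixWord x n).length = n := by simp [prefixWord]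
  rw [corrPoly, corrFinset, hlen, Finset.sum_filter, Finset.sum_div, ← Finset.sum_range_reflect]
  refine Finset.sum_congr rfl fun k hk => ?_
  rw [Finset.mem_range] at hk
  simp only [corrIdx_prefixWord_iff x hk, hk, true_and]
  split_ifs
  · rw [div_eq_iff (pow_ne_zero _ hz), inv_pow, eq_inv_mul_iff_mul_eq₀ (pow_ne_zero _ hz),
      ← pow_add]
    congr 1
    omega
  · exact zero_div _

open scoped Classical in
theorem tendsto_corrPoly_prefixWord_div {A : Type*} (x : ℕ → A) {z : ℝ} (hz : 1 < z) :
    Tendsto (fun n : ℕ => corrPoly (prefixWord x n) (prefixWord x n) z / z ^ (n - 1)) atTop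
      (𝓝 (∑' k, if Function.Periodic x k then z⁻¹ ^ k else 0)) := by
  have hz0 : 0 < z := zero_lt_one.trans hz
  simp only [corrPoly_prefixWord_div_eq_tsum x hz0.ne']
  refine tendsto_tsum_of_dominated_convergence (bound := fun k => z⁻¹ ^ k)
    (summable_geometric_of_lt_one (inv_nonneg.2 hz0.le) (inv_lt_one_of_one_lt₀ hz))
    (fun k => ?_) (Eventually.of_forall fun n k => ?_)
  · refine tendsto_const_nhds.congr' ?_
    by_cases hper : Function.Periodic x k
    · filter_upwards [eventually_gt_atTop k] with n hn
      rw [if_pos hper, if_pos ⟨hn, fun j _ => hper j⟩]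
    · obtain ⟨j, hj⟩ := not_forall.1 hper
      filter_upwards [eventually_gt_atTop (j + k)] with n hn
      rw [if_neg hper, if_neg fun h => hj (h.2 j hn)]
  · have : 0 ≤ z⁻¹ ^ k := by positivity
    split_ifs
    · rw [Real.norm_of_nonneg this]
    · simpa using this

theorem periodic_iff_dvd_of_least {A : Type*} {x : ℕ → A} {s : ℕ} (hs : 0 < s)
    (hper : Function.Periodic x s)
    (hmin : ∀ t : ℕ, 0 < t → t < s → ¬ Function.Periodic x t) (k : ℕ) :
    Function.Periodic x k ↔ s ∣ k := by
  constructor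
  · intro hk
    by_contra hdvd
    refine hmin (k % s) (Nat.pos_of_ne_zero fun h => hdvd (Nat.dvd_of_mod_eq_zero h))
      (Nat.mod_lt _ hs) fun j => ?_
    rw [← hper.nat_mul (k / s) (j + k % s), Nat.cast_id, add_assoc, mul_comm, Nat.mod_add_div, hk]
  · rintro ⟨m, rfl⟩
    simpa [mul_comm] using hper.nat_mul m

/-- Limits of the normalized autocorrelation polynomials of the prefixes of a one-sided
sequence: `1` in the non-periodic case and `1/(1 − z^{−s})` in the periodic case. -/
theorem autocorrelation_limit {A : Type*} [Fintype A] (x : ℕ → A) (z : ℝ) (hz : 1 < z) :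
    ((∀ s : ℕ, 0 < s → ¬ Function.Periodic x s) →
      Filter.Tendsto
        (fun n : ℕ => corrPoly (prefixWord x n) (prefixWord x n) z / z ^ (n - 1))
        Filter.atTop (nhds 1)) ∧
    (∀ s : ℕ, 0 < s → Function.Periodic x s →
      (∀ t : ℕ, 0 < t → t < s → ¬ Function.Periodic x t) →
      Filter.Tendsto
        (fun n : ℕ => corrPoly (prefixWord x n) (prefixWord x n) z / z ^ (n - 1))
        Filter.atTop (nhds (1 - (z ^ s)⁻¹)⁻¹)) := by
  classical
  have hlim := tendsto_corrPoly_prefixWord_div x hz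
  refine ⟨fun hnon => ?_, fun s hs hper hmin => ?_⟩
  · rwa [tsum_eq_single 0 fun k hk => if_neg (hnon k (Nat.pos_of_ne_zero hk)),
      if_pos (by intro j; simp), pow_zero] at hlim
  · simp only [periodic_iff_dvd_of_least hs hper hmin] at hlim
    have hinj : Function.Injective fun m : ℕ => s * m := fun a b h => Nat.eq_of_mul_eq_mul_left hs h
    have hzs : (z ^ s)⁻¹ < 1 := inv_lt_one_of_one_lt₀ (one_lt_pow₀ hz hs.ne')
    have hsum : HasSum (fun k : ℕ => if s ∣ k then z⁻¹ ^ k else 0) (1 - (z ^ s)⁻¹)⁻¹ := by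
      rw [← hinj.hasSum_iff fun k hk => if_neg fun ⟨m, hm⟩ => hk ⟨m, hm.symm⟩]
      refine (hasSum_geometric_of_lt_one (by positivity) hzs).congr_fun fun m => ?_
      simp [pow_mul]
    rwa [hsum.tsum_eq] at hlim
end
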